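/- Let l ≥ 1 be real, m₁, m₂ ∈ ℝ, and let p ∈ S^{m₁,m₂} vanish on the set {(x,ξ) ∈ ℝ² : h₀(x,ξ) ≤ E₀} for some E₀ > V(0). Then the averaged function E ↦ ⟨p⟩(E) is C^∞ on (V(0),∞), vanishes for V(0) < E ≤ E₀, and belongs to S̃^{m₁+[m₂]}: for every integer k ≥ 0 there is a constant C_k such that |∂_E^k ⟨p⟩(E)| ≤ C_k ⟨E⟩^{(m₁+[m₂])/(2l) − k} for all E > V(0). -/

import Mathlib

open Real MeasureTheory intervalIntegral

noncomputable section

/-- Japanese bracket `⟨x⟩ = √(1+x²)`. -/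
def jap (x : ℝ) : ℝ := Real.sqrt (1 + x ^ 2)

/-- The weight `λ(x,ξ) = (1+ξ²+|x|^{2l})^{1/(2l)}`. -/
def lam (l x ξ : ℝ) : ℝ := (1 + ξ ^ 2 + |x| ^ (2 * l)) ^ (1 / (2 * l))

/-- The symbol class `S^{m₁,m₂}`:  `g ∈ C^∞(ℝ²)` with
`|∂_ξ^{k₁}∂_x^{k₂} g(x,ξ)| ≤ C λ(x,ξ)^{m₁-k₁ l} ⟨x⟩^{m₂-k₂}`. -/
def IsSymbol (l m₁ m₂ : ℝ) (g : ℝ → ℝ → ℝ) : Prop :=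
  ContDiff ℝ (⊤ : ℕ∞) (fun q : ℝ × ℝ => g q.1 q.2) ∧
  ∀ k₁ k₂ : ℕ, ∃ C : ℝ, ∀ x ξ : ℝ,
    |iteratedDeriv k₁ (fun ξ' => iteratedDeriv k₂ (fun x' => g x' ξ') x) ξ|
      ≤ C * lam l x ξ ^ (m₁ - (k₁ : ℝ) * l) * jap x ^ (m₂ - (k₂ : ℝ))

/-- The standing assumptions on the potential `V`: it is `C^∞`, even, has no critical
points away from `0`, satisfies the symbol bounds `|∂_x^k V| ≤ C_k ⟨x⟩^{2l-k}`, and admits an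
asymptotic expansion `V(x) ∼ |x|^{2l} + Σ_{j≥1} V_{2l-2j}(x)` with `V_{2l-2j}` smooth away
from zero and positively homogeneous of degree `2l-2j`. -/
structure GoodPotential (l : ℝ) (V : ℝ → ℝ) : Prop where
  smooth : ContDiff ℝ (⊤ : ℕ∞) V
  even : ∀ x : ℝ, V (-x) = V x
  deriv_ne : ∀ x : ℝ, x ≠ 0 → deriv V x ≠ 0
  growth : ∀ k : ℕ, ∃ C : ℝ, ∀ x : ℝ, |iteratedDeriv k V x| ≤ C * jap x ^ (2 * l - (k : ℝ))
  expansion : ∃ Vh : ℕ → ℝ → ℝ,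
    (∀ j : ℕ, 1 ≤ j →
      ContDiffOn ℝ (⊤ : ℕ∞) (Vh j) {x : ℝ | x ≠ 0} ∧
      ∀ ρ : ℝ, 0 < ρ → ∀ x : ℝ, Vh j (ρ * x) = ρ ^ (2 * l - 2 * (j : ℝ)) * Vh j x) ∧
    ∀ N k : ℕ, ∃ C R : ℝ, ∀ x : ℝ, R ≤ |x| →
      |iteratedDeriv k (fun y => V y - |y| ^ (2 * l) - ∑ j ∈ Finset.Icc 1 N, Vh j y) x|
        ≤ C * |x| ^ (2 * l - 2 * ((N : ℝ) + 1) - (k : ℝ))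

/-- `qM` is the turning point function: the unique positive solution of `V(q_M(E)) = E`
for `E > V 0`. -/
def IsTurningPoint (V qM : ℝ → ℝ) : Prop :=
  ∀ E : ℝ, V 0 < E →
    0 < qM E ∧ V (qM E) = E ∧ ∀ q : ℝ, 0 < q → V q = E → q = qM E

/-- The period `T(E) = 4∫₀^{q_M(E)} dq/√(E-V(q))`. -/
def period (V qM : ℝ → ℝ) (E : ℝ) : ℝ :=
  4 * ∫ q in (0:ℝ)..(qM E), (Real.sqrt (E - V q))⁻¹

/-- The orbit average
`⟨p⟩(E) = (1/T(E)) ∫_{-q_M}^{q_M} [p(q,√(E-V q)) + p(q,-√(E-V q))]/√(E-V q) dq`. -/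
def orbitAvg (V qM : ℝ → ℝ) (p : ℝ → ℝ → ℝ) (E : ℝ) : ℝ :=
  (period V qM E)⁻¹ *
    ∫ q in (-(qM E))..(qM E),
      (p q (Real.sqrt (E - V q)) + p q (-Real.sqrt (E - V q))) / Real.sqrt (E - V q)


/-- Families `a(τ, s)` which are `n` times differentiable in `τ`, with derivatives that are jointly
continuous and `O(exp (μ τ))` on `τ ≥ τ₀`, uniformly in the parameter `s`. -/
def ExpSymbol (τ₀ : ℝ) : ℕ → ℝ → (ℝ → ℝ → ℝ) → Prop
  | 0, μ, a => Continuous (fun q : ℝ × ℝ => a q.1 q.2) ∧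
      ∃ C : ℝ, ∀ τ s : ℝ, τ₀ ≤ τ → |a τ s| ≤ C * Real.exp (μ * τ)
  | n + 1, μ, a => (Continuous (fun q : ℝ × ℝ => a q.1 q.2) ∧
      ∃ C : ℝ, ∀ τ s : ℝ, τ₀ ≤ τ → |a τ s| ≤ C * Real.exp (μ * τ)) ∧
      ∃ b : ℝ → ℝ → ℝ, ExpSymbol τ₀ n μ b ∧
        ∀ τ s : ℝ, HasDerivAt (fun t => a t s) (b τ s) τ

namespace ExpSymbol

variable {τ₀ μ ν : ℝ} {n : ℕ} {a b : ℝ → ℝ → ℝ}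

lemma zero_of (h : ExpSymbol τ₀ n μ a) : ExpSymbol τ₀ 0 μ a := by
  cases n with
  | zero => exact h
  | succ n => exact h.1

lemma pred (h : ExpSymbol τ₀ (n + 1) μ a) : ExpSymbol τ₀ n μ a := by
  induction n generalizing a with
  | zero => exact h.1
  | succ n ih =>
    obtain ⟨h0, b, hb, hd⟩ := h
    exact ⟨h0, b, ih hb, hd⟩

lemma continuous (h : ExpSymbol τ₀ n μ a) : Continuous (fun q : ℝ × ℝ => a q.1 q.2) :=
  h.zero_of.1

lemma bound (h : ExpSymbol τ₀ n μ a) :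
    ∃ C : ℝ, 0 ≤ C ∧ ∀ τ s : ℝ, τ₀ ≤ τ → |a τ s| ≤ C * Real.exp (μ * τ) := by
  obtain ⟨C, hC⟩ := h.zero_of.2
  refine ⟨|C|, abs_nonneg C, fun τ s hτ => (hC τ s hτ).trans ?_⟩
  gcongr
  exact le_abs_self C

lemma const (τ₀ : ℝ) (n : ℕ) (c : ℝ) : ExpSymbol τ₀ n 0 (fun _ _ => c) := by
  induction n generalizing c with
  | zero => exact ⟨continuous_const, |c|, fun τ s _ => by simp⟩
  | succ n ih =>
    exact ⟨⟨continuous_const, |c|, fun τ s _ => by simp⟩, _, ih 0,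
      fun τ s => hasDerivAt_const τ c⟩

lemma of_continuous_bounded (τ₀ : ℝ) (n : ℕ) {c : ℝ → ℝ} (hc : Continuous c) {C : ℝ}
    (hC : ∀ s, |c s| ≤ C) : ExpSymbol τ₀ n 0 (fun _ s => c s) := by
  have h0 : ExpSymbol τ₀ 0 0 (fun _ s => c s) :=
    ⟨hc.comp continuous_snd, C, fun τ s _ => by simpa using hC s⟩
  cases n with
  | zero => exact h0
  | succ n => exact ⟨h0, _, const τ₀ n 0, fun τ s => hasDerivAt_const τ (c s)⟩

lemma add (ha : ExpSymbol τ₀ n μ a) (hb : ExpSymbol τ₀ n μ b) :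
    ExpSymbol τ₀ n μ (fun τ s => a τ s + b τ s) := by
  have h0 : ∀ {n : ℕ} {a b : ℝ → ℝ → ℝ}, ExpSymbol τ₀ n μ a → ExpSymbol τ₀ n μ b →
      ExpSymbol τ₀ 0 μ (fun τ s => a τ s + b τ s) := by
    intro n a b ha hb
    obtain ⟨C, -, hC⟩ := ha.bound
    obtain ⟨D, -, hD⟩ := hb.bound
    refine ⟨ha.continuous.add hb.continuous, C + D, fun τ s hτ => ?_⟩
    have := abs_add_le (a τ s) (b τ s)
    linarith [hC τ s hτ, hD τ s hτ, add_mul C D (Real.exp (μ * τ))]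
  induction n generalizing a b with
  | zero => exact h0 ha hb
  | succ n ih =>
    refine ⟨h0 ha hb, ?_⟩
    obtain ⟨-, a', ha', hda⟩ := ha
    obtain ⟨-, b', hb', hdb⟩ := hb
    exact ⟨_, ih ha' hb', fun τ s => (hda τ s).add (hdb τ s)⟩

lemma mul (ha : ExpSymbol τ₀ n μ a) (hb : ExpSymbol τ₀ n ν b) :
    ExpSymbol τ₀ n (μ + ν) (fun τ s => a τ s * b τ s) := by
  have h0 : ∀ {n : ℕ} {a b : ℝ → ℝ → ℝ}, ExpSymbol τ₀ n μ a → ExpSymbol τ₀ n ν b →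
      ExpSymbol τ₀ 0 (μ + ν) (fun τ s => a τ s * b τ s) := by
    intro n a b ha hb
    obtain ⟨C, hC0, hC⟩ := ha.bound
    obtain ⟨D, hD0, hD⟩ := hb.bound
    refine ⟨ha.continuous.mul hb.continuous, C * D, fun τ s hτ => ?_⟩
    rw [abs_mul, add_mul, Real.exp_add]
    calc |a τ s| * |b τ s| ≤ (C * Real.exp (μ * τ)) * (D * Real.exp (ν * τ)) := by
          gcongr
          exacts [hC τ s hτ, hD τ s hτ]
      _ = _ := by ring
  induction n generalizing a b with
  | zero => exact h0 ha hb
  | succ n ih =>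
    refine ⟨h0 ha hb, ?_⟩
    have ha₁ := ha.pred
    have hb₁ := hb.pred
    obtain ⟨-, a', ha', hda⟩ := ha
    obtain ⟨-, b', hb', hdb⟩ := hb
    exact ⟨_, (ih ha' hb₁).add (ih ha₁ hb'), fun τ s => (hda τ s).mul (hdb τ s)⟩

lemma const_mul (c : ℝ) (ha : ExpSymbol τ₀ n μ a) :
    ExpSymbol τ₀ n μ (fun τ s => c * a τ s) := by
  simpa using (const τ₀ n c).mul ha

lemma sub (ha : ExpSymbol τ₀ n μ a) (hb : ExpSymbol τ₀ n μ b) :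
    ExpSymbol τ₀ n μ (fun τ s => a τ s - b τ s) := by
  simpa [sub_eq_add_neg] using ha.add (hb.const_mul (-1))

lemma mono (hμ : μ ≤ ν) (ha : ExpSymbol τ₀ n μ a) : ExpSymbol τ₀ n ν a := by
  have h0 : ∀ {n : ℕ} {a : ℝ → ℝ → ℝ}, ExpSymbol τ₀ n μ a → ExpSymbol τ₀ 0 ν a := by
    intro n a ha
    obtain ⟨C, hC0, hC⟩ := ha.bound
    refine ⟨ha.continuous, C * Real.exp ((μ - ν) * τ₀), fun τ s hτ => (hC τ s hτ).trans ?_⟩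
    rw [mul_assoc, ← Real.exp_add]
    gcongr
    nlinarith
  induction n generalizing a with
  | zero => exact h0 ha
  | succ n ih =>
    refine ⟨h0 ha, ?_⟩
    obtain ⟨-, a', ha', hda⟩ := ha
    exact ⟨a', ih ha', hda⟩

/-- A family with logarithmic derivative of order zero is a symbol. -/
lemma of_logDeriv {α : ℝ → ℝ → ℝ} (hα : ∀ k < n, ExpSymbol τ₀ k 0 α)
    (ha : ExpSymbol τ₀ 0 μ a) (hd : ∀ τ s : ℝ, HasDerivAt (fun t => a t s) (α τ s * a τ s) τ) :
    ExpSymbol τ₀ n μ a := by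
  induction n with
  | zero => exact ha
  | succ n ih =>
    have h := (hα n n.lt_succ_self).mul (ih fun k hk => hα k (hk.trans n.lt_succ_self))
    rw [zero_add] at h
    exact ⟨ha, _, h, hd⟩

lemma exp (τ₀ : ℝ) (n : ℕ) (μ : ℝ) : ExpSymbol τ₀ n μ (fun τ _ => Real.exp (μ * τ)) := by
  refine of_logDeriv (α := fun _ _ => μ) (fun k _ => const τ₀ k μ)
    ⟨by fun_prop, 1, fun τ s _ => by simp⟩ fun τ s => ?_
  simpa [mul_comm] using ((hasDerivAt_id τ).const_mul μ).exp

end ExpSymbol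

lemma rpow_le_of_comparable {c C e N : ℝ} (hc : 0 < c) (he : 0 < e) (h₁ : c * e ≤ N)
    (h₂ : N ≤ C * e) (ρ : ℝ) : N ^ ρ ≤ (c ^ ρ + C ^ ρ) * e ^ ρ := by
  have hce : 0 < c * e := mul_pos hc he
  have hN : 0 < N := hce.trans_le h₁
  have hC : 0 < C := by
    by_contra! h
    nlinarith
  have hp := Real.rpow_pos_of_pos hc ρ
  have hq := Real.rpow_pos_of_pos hC ρ
  have hr := Real.rpow_pos_of_pos he ρ
  rcases le_total 0 ρ with h | h
  · calc N ^ ρ ≤ (C * e) ^ ρ := Real.rpow_le_rpow hN.le h₂ h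
      _ = C ^ ρ * e ^ ρ := Real.mul_rpow hC.le he.le
      _ ≤ _ := by nlinarith
  · calc N ^ ρ ≤ (c * e) ^ ρ := Real.rpow_le_rpow_of_nonpos hce h₁ h
      _ = c ^ ρ * e ^ ρ := Real.mul_rpow hc.le he.le
      _ ≤ _ := by nlinarith

namespace ExpSymbol

variable {τ₀ μ ν : ℝ} {n : ℕ} {a b : ℝ → ℝ → ℝ}

lemma rpow (ha : ExpSymbol τ₀ n μ a) (hpos : ∀ τ s, 0 < a τ s) {c : ℝ} (hc : 0 < c)
    (hlow : ∀ τ s, τ₀ ≤ τ → c * Real.exp (μ * τ) ≤ a τ s) (ρ : ℝ) :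
    ExpSymbol τ₀ n (ρ * μ) (fun τ s => a τ s ^ ρ) := by
  have h0 : ∀ ρ : ℝ, ExpSymbol τ₀ 0 (ρ * μ) (fun τ s => a τ s ^ ρ) := by
    intro ρ
    obtain ⟨C, -, hC⟩ := ha.bound
    refine ⟨ha.continuous.rpow_const fun q => Or.inl (hpos _ _).ne', c ^ ρ + C ^ ρ,
      fun τ s hτ => ?_⟩
    rw [abs_of_pos (Real.rpow_pos_of_pos (hpos τ s) ρ)]
    have := rpow_le_of_comparable hc (Real.exp_pos (μ * τ)) (hlow τ s hτ)
      ((le_abs_self _).trans (hC τ s hτ)) ρ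
    rwa [← Real.exp_mul, show μ * τ * ρ = ρ * μ * τ by ring] at this
  induction n generalizing ρ with
  | zero => exact h0 ρ
  | succ n ih =>
    obtain ⟨-, a', ha', hda⟩ := id ha
    have h := (ha'.mul (ih ha.pred (ρ - 1))).const_mul ρ
    rw [show μ + (ρ - 1) * μ = ρ * μ by ring] at h
    refine ⟨h0 ρ, _, h, fun τ s => ?_⟩
    convert (hda τ s).rpow_const (p := ρ) (Or.inl (hpos τ s).ne') using 1
    ring

lemma inv (ha : ExpSymbol τ₀ n μ a) (hpos : ∀ τ s, 0 < a τ s) {c : ℝ} (hc : 0 < c)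
    (hlow : ∀ τ s, τ₀ ≤ τ → c * Real.exp (μ * τ) ≤ a τ s) :
    ExpSymbol τ₀ n (-μ) (fun τ s => (a τ s)⁻¹) := by
  simpa [Real.rpow_neg_one] using ha.rpow hpos hc hlow (-1)

lemma sqrt (ha : ExpSymbol τ₀ n μ a) (hpos : ∀ τ s, 0 < a τ s) {c : ℝ} (hc : 0 < c)
    (hlow : ∀ τ s, τ₀ ≤ τ → c * Real.exp (μ * τ) ≤ a τ s) :
    ExpSymbol τ₀ n (μ / 2) (fun τ s => √(a τ s)) := by
  simpa [Real.sqrt_eq_rpow, div_eq_inv_mul] using ha.rpow hpos hc hlow (1 / 2)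

lemma integral (ha : ExpSymbol τ₀ n μ a) (u v : ℝ) :
    ExpSymbol τ₀ n μ (fun τ _ => ∫ s in u..v, a τ s) := by
  have h0 : ∀ {n : ℕ} {a : ℝ → ℝ → ℝ}, ExpSymbol τ₀ n μ a →
      ExpSymbol τ₀ 0 μ (fun τ _ => ∫ s in u..v, a τ s) := by
    intro n a ha
    obtain ⟨C, hC0, hC⟩ := ha.bound
    refine ⟨(intervalIntegral.continuous_parametric_intervalIntegral_of_continuous'
      (f := a) ha.continuous u v).comp continuous_fst, C * |v - u|, fun τ s hτ => ?_⟩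
    refine (intervalIntegral.norm_integral_le_of_norm_le_const
      (f := fun t => a τ t) (C := C * Real.exp (μ * τ)) fun t _ => hC τ t hτ).trans (le_of_eq ?_)
    ring
  induction n generalizing a with
  | zero => exact h0 ha
  | succ n ih =>
    refine ⟨h0 ha, ?_⟩
    have hca := ha.continuous
    obtain ⟨-, b, hb, hd⟩ := ha
    refine ⟨_, ih hb, fun τ s => ?_⟩
    have hcb := hb.continuous
    obtain ⟨C, hC⟩ := ((isCompact_Icc (a := τ - 1) (b := τ + 1)).prod
      (isCompact_uIcc (a := u) (b := v))).exists_bound_of_continuousOn hcb.continuousOn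
    refine (intervalIntegral.hasDerivAt_integral_of_dominated_loc_of_deriv_le
      (F := a) (F' := b) (bound := fun _ => C) (s := Set.Icc (τ - 1) (τ + 1))
      (Icc_mem_nhds (by linarith) (by linarith)) ?_ ?_ ?_ ?_ ?_ ?_).2
    · exact Filter.Eventually.of_forall fun t => Continuous.aestronglyMeasurable (by fun_prop)
    · exact Continuous.intervalIntegrable (by fun_prop) _ _
    · exact Continuous.aestronglyMeasurable (by fun_prop)
    · exact Filter.Eventually.of_forall fun t ht x hx =>
        hC (x, t) ⟨hx, Set.uIoc_subset_uIcc ht⟩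
    · exact intervalIntegrable_const
    · exact Filter.Eventually.of_forall fun t _ x _ => hd x t

lemma contDiffOn_comp_log {Φ : ℝ → ℝ → ℝ} (hΦ : ExpSymbol τ₀ n μ Φ) {v₀ : ℝ} {f : ℝ → ℝ}
    (hf : ∀ E, v₀ < E → f E = (E - v₀) ^ ν * Φ (Real.log (E - v₀)) 0) :
    ContDiffOn ℝ n f (Set.Ioi v₀) ∧ ∀ k ≤ n, ∃ C, ∀ E, v₀ + Real.exp τ₀ ≤ E →
      |iteratedDerivWithin k f (Set.Ioi v₀) E| ≤ C * (E - v₀) ^ (μ + ν - k) := by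
  have h0 : ∃ C, ∀ E, v₀ + Real.exp τ₀ ≤ E →
      |iteratedDerivWithin 0 f (Set.Ioi v₀) E| ≤ C * (E - v₀) ^ (μ + ν - (0 : ℕ)) := by
    obtain ⟨C, hC0, hC⟩ := hΦ.bound
    refine ⟨C, fun E hE => ?_⟩
    have he : 0 < E - v₀ := by linarith [Real.exp_pos τ₀]
    have hlog : τ₀ ≤ Real.log (E - v₀) := (Real.le_log_iff_exp_le he).2 (by linarith)
    rw [iteratedDerivWithin_zero, hf E (by linarith), abs_mul,
      abs_of_pos (Real.rpow_pos_of_pos he ν), Nat.cast_zero, sub_zero, Real.rpow_add he,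
      Real.rpow_def_of_pos he μ, mul_comm (Real.log _) μ]
    have := mul_le_mul_of_nonneg_left (hC _ 0 hlog) (Real.rpow_pos_of_pos he ν).le
    linarith
  induction n generalizing f Φ ν with
  | zero =>
    refine ⟨?_, fun k hk => ?_⟩
    · rw [Nat.cast_zero, contDiffOn_zero]
      have hc : ContinuousOn (fun E => (E - v₀) ^ ν * Φ (Real.log (E - v₀)) 0) (Set.Ioi v₀) := by
        refine ContinuousOn.mul (ContinuousOn.rpow_const (by fun_prop) fun E hE => ?_) ?_
        · exact Or.inl (sub_pos.2 hE).ne'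
        · exact (hΦ.continuous.comp (Continuous.prodMk_left (0:ℝ))).comp_continuousOn
            (ContinuousOn.log (by fun_prop) fun E hE => (sub_pos.2 hE).ne')
      exact hc.congr fun E hE => hf E hE
    · obtain rfl : k = 0 := by omega
      exact h0
  | succ n ih =>
    have hΦ' := hΦ.pred
    obtain ⟨-, b, hb, hd⟩ := id hΦ
    have hder : ∀ E ∈ Set.Ioi v₀, HasDerivAt f ((E - v₀) ^ (ν - 1) *
        (ν * Φ (Real.log (E - v₀)) 0 + b (Real.log (E - v₀)) 0)) E := by
      intro E hE
      have he : 0 < E - v₀ := sub_pos.2 hE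
      have h1 : HasDerivAt (fun E => E - v₀) 1 E := (hasDerivAt_id E).sub_const v₀
      have h2 := (h1.rpow_const (p := ν) (Or.inl he.ne')).mul
        (HasDerivAt.comp E (hd (Real.log (E - v₀)) 0) (h1.log he.ne'))
      refine (h2.congr_of_eventuallyEq ?_).congr_deriv ?_
      · filter_upwards [Ioi_mem_nhds hE] with x hx using hf x hx
      · have : (E - v₀) ^ ν = (E - v₀) ^ (ν - 1) * (E - v₀) := by
          rw [Real.rpow_sub_one he.ne']; field_simp
        simp only [Function.comp, this]
        field_simp
    have hdw : ∀ E ∈ Set.Ioi v₀, derivWithin f (Set.Ioi v₀) E = (E - v₀) ^ (ν - 1) *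
        (ν * Φ (Real.log (E - v₀)) 0 + b (Real.log (E - v₀)) 0) := fun E hE =>
      (hder E hE).hasDerivWithinAt.derivWithin (isOpen_Ioi.uniqueDiffWithinAt hE)
    have hS := (hΦ'.const_mul ν).add hb
    have hS0 : ∃ C, ∀ E, v₀ + Real.exp τ₀ ≤ E →
        |iteratedDerivWithin 0 (derivWithin f (Set.Ioi v₀)) (Set.Ioi v₀) E|
          ≤ C * (E - v₀) ^ (μ + (ν - 1) - (0 : ℕ)) := by
      obtain ⟨C, hC0, hC⟩ := hS.bound
      refine ⟨C, fun E hE => ?_⟩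
      have he : 0 < E - v₀ := by linarith [Real.exp_pos τ₀]
      have hlog : τ₀ ≤ Real.log (E - v₀) := (Real.le_log_iff_exp_le he).2 (by linarith)
      rw [iteratedDerivWithin_zero, hdw E (sub_pos.1 he), abs_mul,
        abs_of_pos (Real.rpow_pos_of_pos he _), Nat.cast_zero, sub_zero, Real.rpow_add he,
        Real.rpow_def_of_pos he μ, mul_comm (Real.log _) μ]
      have := mul_le_mul_of_nonneg_left (hC _ 0 hlog) (Real.rpow_pos_of_pos he (ν - 1)).le
      linarith
    obtain ⟨hcd, hbd⟩ := ih hS (ν := ν - 1) (f := derivWithin f (Set.Ioi v₀)) hdw hS0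
    refine ⟨?_, fun k hk => ?_⟩
    · rw [Nat.cast_succ, contDiffOn_succ_iff_derivWithin (uniqueDiffOn_Ioi v₀)]
      exact ⟨fun E hE => (hder E hE).differentiableAt.differentiableWithinAt, by simp, hcd⟩
    · cases k with
      | zero => exact h0
      | succ k =>
        obtain ⟨C, hC⟩ := hbd k (by omega)
        refine ⟨C, fun E hE => ?_⟩
        rw [iteratedDerivWithin_succ']
        convert hC E hE using 3
        push_cast
        ring

end ExpSymbol

lemma one_le_lam {l : ℝ} (hl : 1 ≤ l) (x ξ : ℝ) : 1 ≤ lam l x ξ :=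
  Real.one_le_rpow (by nlinarith [sq_nonneg ξ, Real.rpow_nonneg (abs_nonneg x) (2 * l)])
    (by positivity)

lemma lam_pos {l : ℝ} (hl : 1 ≤ l) (x ξ : ℝ) : 0 < lam l x ξ :=
  zero_lt_one.trans_le (one_le_lam hl x ξ)

lemma lam_rpow {l : ℝ} (x ξ m : ℝ) :
    lam l x ξ ^ m = (1 + ξ ^ 2 + |x| ^ (2 * l)) ^ (m / (2 * l)) := by
  rw [lam, ← Real.rpow_mul (by positivity)]
  ring_nf

lemma one_le_jap (x : ℝ) : 1 ≤ jap x := by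
  rw [jap, Real.one_le_sqrt]
  nlinarith [sq_nonneg x]

lemma jap_pos (x : ℝ) : 0 < jap x := zero_lt_one.trans_le (one_le_jap x)

lemma abs_le_jap (x : ℝ) : |x| ≤ jap x := Real.abs_le_sqrt (by linarith)

lemma jap_rpow_le {l : ℝ} (hl : 1 ≤ l) (x : ℝ) :
    jap x ^ (2 * l) ≤ 2 ^ l * (1 + |x| ^ (2 * l)) := by
  have h1 : jap x ^ (2 * l) = (1 + x ^ 2) ^ l := by
    rw [jap, Real.sqrt_eq_rpow, ← Real.rpow_mul (by positivity)]
    ring_nf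
  have h2 : |x| ^ (2 * l) = (x ^ 2) ^ l := by
    rw [← sq_abs, ← Real.rpow_natCast, ← Real.rpow_mul (abs_nonneg x)]
    norm_num
  rw [h1, h2]
  rcases le_total (x ^ 2) 1 with h | h
  · calc (1 + x ^ 2) ^ l ≤ 2 ^ l := Real.rpow_le_rpow (by positivity) (by linarith) (by linarith)
      _ ≤ _ := le_mul_of_one_le_right (by positivity)
          (by linarith [Real.rpow_nonneg (sq_nonneg x) l])
  · calc (1 + x ^ 2) ^ l ≤ (2 * x ^ 2) ^ l :=
          Real.rpow_le_rpow (by positivity) (by linarith) (by linarith)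
      _ = 2 ^ l * (x ^ 2) ^ l := Real.mul_rpow (by norm_num) (sq_nonneg x)
      _ ≤ _ := by gcongr; linarith

lemma jap_le_lam {l : ℝ} (hl : 1 ≤ l) (x ξ : ℝ) : jap x ≤ 2 * lam l x ξ := by
  have h0 : 0 < 2 * l := by linarith
  refine (Real.rpow_le_rpow_iff (jap_pos x).le (by linarith [lam_pos hl x ξ]) h0).1 ?_
  rw [Real.mul_rpow (by norm_num) (lam_pos hl x ξ).le, lam_rpow, div_self h0.ne', Real.rpow_one]
  refine (jap_rpow_le hl x).trans ?_
  gcongr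
  · norm_num
  · linarith
  · linarith [sq_nonneg ξ]

lemma abs_le_lam_rpow {l : ℝ} (hl : 1 ≤ l) (x ξ : ℝ) : |ξ| ≤ lam l x ξ ^ l := by
  rw [lam_rpow, show l / (2 * l) = 1 / 2 by field_simp, ← Real.sqrt_eq_rpow]
  exact Real.abs_le_sqrt (by linarith [Real.rpow_nonneg (abs_nonneg x) (2 * l)])

/-- Functions on phase space which, together with at most `n` applications of the vector fields
`x ∂_x` and `ξ ∂_ξ`, are continuous and `O(λ ^ m)`. -/
def PhaseSymbol (l m : ℝ) : ℕ → (ℝ → ℝ → ℝ) → Prop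
  | 0, f => Continuous (fun q : ℝ × ℝ => f q.1 q.2) ∧
      ∃ C : ℝ, ∀ x ξ : ℝ, |f x ξ| ≤ C * lam l x ξ ^ m
  | n + 1, f => (Continuous (fun q : ℝ × ℝ => f q.1 q.2) ∧
      ∃ C : ℝ, ∀ x ξ : ℝ, |f x ξ| ≤ C * lam l x ξ ^ m) ∧
      ∃ g h : ℝ → ℝ → ℝ, PhaseSymbol l m n (fun x ξ => x * g x ξ) ∧
        PhaseSymbol l m n (fun x ξ => ξ * h x ξ) ∧
        ∀ (u v : ℝ → ℝ) (u' v' t : ℝ), HasDerivAt u u' t → HasDerivAt v v' t →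
          HasDerivAt (fun t => f (u t) (v t)) (g (u t) (v t) * u' + h (u t) (v t) * v') t

namespace PhaseSymbol

variable {l m : ℝ} {n : ℕ} {f g : ℝ → ℝ → ℝ}

lemma zero_of (h : PhaseSymbol l m n f) : PhaseSymbol l m 0 f := by
  cases n with
  | zero => exact h
  | succ n => exact h.1

lemma add (hf : PhaseSymbol l m n f) (hg : PhaseSymbol l m n g) :
    PhaseSymbol l m n (fun x ξ => f x ξ + g x ξ) := by
  have h0 : ∀ {n : ℕ} {f g : ℝ → ℝ → ℝ}, PhaseSymbol l m n f → PhaseSymbol l m n g →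
      PhaseSymbol l m 0 (fun x ξ => f x ξ + g x ξ) := by
    intro n f g hf hg
    obtain ⟨hfc, C, hC⟩ := hf.zero_of
    obtain ⟨hgc, D, hD⟩ := hg.zero_of
    refine ⟨hfc.add hgc, C + D, fun x ξ => ?_⟩
    have := abs_add_le (f x ξ) (g x ξ)
    linarith [hC x ξ, hD x ξ, add_mul C D (lam l x ξ ^ m)]
  induction n generalizing f g with
  | zero => exact h0 hf hg
  | succ n ih =>
    refine ⟨h0 hf hg, ?_⟩
    obtain ⟨-, f₁, f₂, hf₁, hf₂, hfd⟩ := hf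
    obtain ⟨-, g₁, g₂, hg₁, hg₂, hgd⟩ := hg
    refine ⟨fun x ξ => f₁ x ξ + g₁ x ξ, fun x ξ => f₂ x ξ + g₂ x ξ, ?_, ?_, ?_⟩
    · simpa only [mul_add] using ih hf₁ hg₁
    · simpa only [mul_add] using ih hf₂ hg₂
    · intro u v u' v' t hu hv
      exact ((hfd u v u' v' t hu hv).add (hgd u v u' v' t hu hv)).congr_deriv (by ring)

lemma const_mul (c : ℝ) (hf : PhaseSymbol l m n f) :
    PhaseSymbol l m n (fun x ξ => c * f x ξ) := by
  have h0 : ∀ {n : ℕ} {f : ℝ → ℝ → ℝ}, PhaseSymbol l m n f →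
      PhaseSymbol l m 0 (fun x ξ => c * f x ξ) := by
    intro n f hf
    obtain ⟨hfc, C, hC⟩ := hf.zero_of
    refine ⟨continuous_const.mul hfc, |c| * C, fun x ξ => ?_⟩
    rw [abs_mul, mul_assoc]
    exact mul_le_mul_of_nonneg_left (hC x ξ) (abs_nonneg c)
  induction n generalizing f with
  | zero => exact h0 hf
  | succ n ih =>
    refine ⟨h0 hf, ?_⟩
    obtain ⟨-, f₁, f₂, hf₁, hf₂, hfd⟩ := hf
    refine ⟨fun x ξ => c * f₁ x ξ, fun x ξ => c * f₂ x ξ, ?_, ?_, ?_⟩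
    · simpa only [mul_left_comm] using ih hf₁
    · simpa only [mul_left_comm] using ih hf₂
    · intro u v u' v' t hu hv
      exact ((hfd u v u' v' t hu hv).const_mul c).congr_deriv (by ring)

lemma const (l : ℝ) (n : ℕ) (c : ℝ) : PhaseSymbol l 0 n (fun _ _ => c) := by
  have h0 : ∀ c : ℝ, PhaseSymbol l 0 0 (fun _ _ => c) := fun c =>
    ⟨continuous_const, |c|, fun x ξ => by simp⟩
  induction n generalizing c with
  | zero => exact h0 c
  | succ n ih =>
    refine ⟨h0 c, fun _ _ => 0, fun _ _ => 0, by simpa using ih 0, by simpa using ih 0, ?_⟩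
    intro u v u' v' t _ _
    simpa using hasDerivAt_const t c

end PhaseSymbol

lemma ExpSymbol.comp_phaseSymbol {l m τ₀ μ : ℝ} {n : ℕ} {f x ξ α β : ℝ → ℝ → ℝ}
    (hf : PhaseSymbol l m n f) (hx : Continuous (fun q : ℝ × ℝ => x q.1 q.2))
    (hξ : Continuous (fun q : ℝ × ℝ => ξ q.1 q.2))
    (hα : ∀ k < n, ExpSymbol τ₀ k 0 α) (hβ : ∀ k < n, ExpSymbol τ₀ k 0 β)
    (hdx : ∀ τ s, HasDerivAt (fun t => x t s) (α τ s * x τ s) τ)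
    (hdξ : ∀ τ s, HasDerivAt (fun t => ξ t s) (β τ s * ξ τ s) τ)
    (hw : ∃ C : ℝ, ∀ τ s, τ₀ ≤ τ → lam l (x τ s) (ξ τ s) ^ m ≤ C * Real.exp (μ * τ)) :
    ExpSymbol τ₀ n μ (fun τ s => f (x τ s) (ξ τ s)) := by
  have h0 : ∀ {n : ℕ} {f : ℝ → ℝ → ℝ}, PhaseSymbol l m n f →
      ExpSymbol τ₀ 0 μ (fun τ s => f (x τ s) (ξ τ s)) := by
    intro n f hf
    obtain ⟨hfc, C, hC⟩ := hf.zero_of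
    obtain ⟨D, hD⟩ := hw
    refine ⟨hfc.comp (hx.prodMk hξ), |C| * D, fun τ s hτ => (hC _ _).trans ?_⟩
    have hl0 : 0 ≤ lam l (x τ s) (ξ τ s) ^ m :=
      Real.rpow_nonneg (Real.rpow_nonneg (by positivity) _) _
    rw [mul_assoc]
    calc C * lam l (x τ s) (ξ τ s) ^ m ≤ |C| * lam l (x τ s) (ξ τ s) ^ m :=
          mul_le_mul_of_nonneg_right (le_abs_self C) hl0
      _ ≤ _ := mul_le_mul_of_nonneg_left (hD τ s hτ) (abs_nonneg C)
  induction n generalizing f with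
  | zero => exact h0 hf
  | succ n ih =>
    refine ⟨h0 hf, ?_⟩
    obtain ⟨-, g, h, hg, hh, hd⟩ := hf
    have hα' := fun k (hk : k < n) => hα k (hk.trans n.lt_succ_self)
    have hβ' := fun k (hk : k < n) => hβ k (hk.trans n.lt_succ_self)
    have h1 := ((hα n n.lt_succ_self).mul (ih hg hα' hβ')).add
      ((hβ n n.lt_succ_self).mul (ih hh hα' hβ'))
    rw [zero_add] at h1
    refine ⟨_, h1, fun τ s => ?_⟩
    exact (hd _ _ _ _ τ (hdx τ s) (hdξ τ s)).congr_deriv (by ring)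

/-- The partial derivative `∂_x` of a function on phase space. -/
def partialX (f : ℝ → ℝ → ℝ) : ℝ → ℝ → ℝ := fun x ξ => deriv (fun x' => f x' ξ) x

/-- The partial derivative `∂_ξ` of a function on phase space. -/
def partialXi (f : ℝ → ℝ → ℝ) : ℝ → ℝ → ℝ := fun x ξ => deriv (fun ξ' => f x ξ') ξ

section Partial

variable {f : ℝ → ℝ → ℝ}

lemma hasDerivAt_partialX (hf : ContDiff ℝ (⊤ : ℕ∞) (fun q : ℝ × ℝ => f q.1 q.2)) (x ξ : ℝ) :
    HasDerivAt (fun x' => f x' ξ) (fderiv ℝ (fun q : ℝ × ℝ => f q.1 q.2) (x, ξ) (1, 0)) x := by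
  have h := (hf.differentiable (by simp) (x, ξ)).hasFDerivAt.comp_hasDerivAt x
    ((hasDerivAt_id' x).prodMk (hasDerivAt_const x ξ))
  exact h

lemma hasDerivAt_partialXi (hf : ContDiff ℝ (⊤ : ℕ∞) (fun q : ℝ × ℝ => f q.1 q.2)) (x ξ : ℝ) :
    HasDerivAt (fun ξ' => f x ξ') (fderiv ℝ (fun q : ℝ × ℝ => f q.1 q.2) (x, ξ) (0, 1)) ξ := by
  have h := (hf.differentiable (by simp) (x, ξ)).hasFDerivAt.comp_hasDerivAt ξ
    ((hasDerivAt_const ξ x).prodMk (hasDerivAt_id' ξ))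
  exact h

lemma partialX_eq (hf : ContDiff ℝ (⊤ : ℕ∞) (fun q : ℝ × ℝ => f q.1 q.2)) :
    (fun q : ℝ × ℝ => partialX f q.1 q.2) =
      fun q => fderiv ℝ (fun q : ℝ × ℝ => f q.1 q.2) q (1, 0) :=
  funext fun q => (hasDerivAt_partialX hf q.1 q.2).deriv

lemma partialXi_eq (hf : ContDiff ℝ (⊤ : ℕ∞) (fun q : ℝ × ℝ => f q.1 q.2)) :
    (fun q : ℝ × ℝ => partialXi f q.1 q.2) =
      fun q => fderiv ℝ (fun q : ℝ × ℝ => f q.1 q.2) q (0, 1) :=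
  funext fun q => (hasDerivAt_partialXi hf q.1 q.2).deriv

lemma contDiff_partialX (hf : ContDiff ℝ (⊤ : ℕ∞) (fun q : ℝ × ℝ => f q.1 q.2)) :
    ContDiff ℝ (⊤ : ℕ∞) (fun q : ℝ × ℝ => partialX f q.1 q.2) := by
  rw [partialX_eq hf]
  exact (hf.fderiv_right (m := (⊤ : ℕ∞)) le_rfl).clm_apply contDiff_const

lemma contDiff_partialXi (hf : ContDiff ℝ (⊤ : ℕ∞) (fun q : ℝ × ℝ => f q.1 q.2)) :
    ContDiff ℝ (⊤ : ℕ∞) (fun q : ℝ × ℝ => partialXi f q.1 q.2) := by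
  rw [partialXi_eq hf]
  exact (hf.fderiv_right (m := (⊤ : ℕ∞)) le_rfl).clm_apply contDiff_const

lemma hasDerivAt_comp_curve (hf : ContDiff ℝ (⊤ : ℕ∞) (fun q : ℝ × ℝ => f q.1 q.2))
    {u v : ℝ → ℝ} {u' v' t : ℝ} (hu : HasDerivAt u u' t) (hv : HasDerivAt v v' t) :
    HasDerivAt (fun t => f (u t) (v t))
      (partialX f (u t) (v t) * u' + partialXi f (u t) (v t) * v') t := by
  have h := (hf.differentiable (by simp) (u t, v t)).hasFDerivAt.comp_hasDerivAt t (hu.prodMk hv)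
  refine h.congr_deriv ?_
  rw [partialX, partialXi, (hasDerivAt_partialX hf _ _).deriv, (hasDerivAt_partialXi hf _ _).deriv,
    show ((u', v') : ℝ × ℝ) = u' • (1, 0) + v' • (0, 1) by simp, map_add, map_smul, map_smul]
  simp [mul_comm]

lemma partialX_partialXi (hf : ContDiff ℝ (⊤ : ℕ∞) (fun q : ℝ × ℝ => f q.1 q.2)) :
    partialX (partialXi f) = partialXi (partialX f) := by
  funext x ξ
  have hs := (hf.contDiffAt (x := (x, ξ))).isSymmSndFDerivAt
    (by rw [minSmoothness_of_isRCLikeNormedField]; exact WithTop.coe_le_coe.2 le_top)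
  have hd : DifferentiableAt ℝ (fderiv ℝ (fun q : ℝ × ℝ => f q.1 q.2)) (x, ξ) :=
    (hf.fderiv_right (m := (⊤ : ℕ∞)) le_rfl).differentiable (by simp) _
  have h1 := congrFun (partialX_eq (contDiff_partialXi hf)) (x, ξ)
  have h2 := congrFun (partialXi_eq (contDiff_partialX hf)) (x, ξ)
  simp only at h1 h2
  rw [h1, h2, partialX_eq hf, partialXi_eq hf, fderiv_clm_apply hd (by simp),
    fderiv_clm_apply hd (by simp)]
  simpa using hs (1, 0) (0, 1)

lemma contDiff_partialX_iterate (hf : ContDiff ℝ (⊤ : ℕ∞) (fun q : ℝ × ℝ => f q.1 q.2)) (a : ℕ) :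
    ContDiff ℝ (⊤ : ℕ∞) (fun q : ℝ × ℝ => partialX^[a] f q.1 q.2) := by
  induction a with
  | zero => exact hf
  | succ a ih =>
    rw [Function.iterate_succ']
    exact contDiff_partialX ih

lemma contDiff_partialXi_iterate (hf : ContDiff ℝ (⊤ : ℕ∞) (fun q : ℝ × ℝ => f q.1 q.2)) (b : ℕ) :
    ContDiff ℝ (⊤ : ℕ∞) (fun q : ℝ × ℝ => partialXi^[b] f q.1 q.2) := by
  induction b with
  | zero => exact hf
  | succ b ih =>
    rw [Function.iterate_succ']
    exact contDiff_partialXi ih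

lemma partialX_partialXi_iterate (hf : ContDiff ℝ (⊤ : ℕ∞) (fun q : ℝ × ℝ => f q.1 q.2)) (b : ℕ) :
    partialX (partialXi^[b] f) = partialXi^[b] (partialX f) := by
  induction b with
  | zero => rfl
  | succ b ih =>
    rw [Function.iterate_succ_apply', partialX_partialXi (contDiff_partialXi_iterate hf b), ih,
      Function.iterate_succ_apply']

lemma iteratedDeriv_eq_partialX (f : ℝ → ℝ → ℝ) (a : ℕ) (ξ : ℝ) :
    iteratedDeriv a (fun x' => f x' ξ) = fun x => partialX^[a] f x ξ := by
  induction a with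
  | zero => simp
  | succ a ih => rw [iteratedDeriv_succ, ih, Function.iterate_succ']; rfl

lemma iteratedDeriv_eq_partialXi (f : ℝ → ℝ → ℝ) (b : ℕ) (x : ℝ) :
    iteratedDeriv b (fun ξ' => f x ξ') = fun ξ => partialXi^[b] f x ξ := by
  induction b with
  | zero => simp
  | succ b ih => rw [iteratedDeriv_succ, ih, Function.iterate_succ']; rfl

end Partial

lemma IsSymbol.phaseSymbol_monomial {l m₁ m₂ : ℝ} (hl : 1 ≤ l) {g : ℝ → ℝ → ℝ}
    (hg : IsSymbol l m₁ m₂ g) (n a b : ℕ) :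
    PhaseSymbol l (m₁ + max m₂ 0) n
      (fun x ξ => x ^ a * ξ ^ b * partialXi^[b] (partialX^[a] g) x ξ) := by
  have hcd : ∀ a b : ℕ, ContDiff ℝ (⊤ : ℕ∞)
      (fun q : ℝ × ℝ => partialXi^[b] (partialX^[a] g) q.1 q.2) := fun a b =>
    contDiff_partialXi_iterate (contDiff_partialX_iterate hg.1 a) b
  have h0 : ∀ a b : ℕ, PhaseSymbol l (m₁ + max m₂ 0) 0
      (fun x ξ => x ^ a * ξ ^ b * partialXi^[b] (partialX^[a] g) x ξ) := by
    intro a b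
    obtain ⟨C, hC⟩ := hg.2 b a
    refine ⟨((continuous_fst.pow a).mul (continuous_snd.pow b)).mul (hcd a b).continuous,
      |C| * 2 ^ max m₂ 0, fun x ξ => ?_⟩
    have hC' := hC x ξ
    have hL := lam_pos hl x ξ
    have hJ := jap_pos x
    simp only [iteratedDeriv_eq_partialX] at hC'
    rw [iteratedDeriv_eq_partialXi] at hC'
    rw [abs_mul, abs_mul, abs_pow, abs_pow]
    calc |x| ^ a * |ξ| ^ b * |partialXi^[b] (partialX^[a] g) x ξ|
        ≤ jap x ^ a * (lam l x ξ ^ l) ^ b *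
          (|C| * lam l x ξ ^ (m₁ - b * l) * jap x ^ (m₂ - a)) := by
          gcongr
          · exact abs_le_jap x
          · exact abs_le_lam_rpow hl x ξ
          · refine hC'.trans ?_
            gcongr
            exact le_abs_self C
      _ = |C| * lam l x ξ ^ m₁ * jap x ^ m₂ := by
          rw [← Real.rpow_natCast, ← Real.rpow_natCast, ← Real.rpow_mul hL.le,
            Real.rpow_sub hL, Real.rpow_sub hJ, mul_comm (b : ℝ) l]
          have h1 := (Real.rpow_pos_of_pos hL (l * b)).ne'
          have h2 := (Real.rpow_pos_of_pos hJ (a : ℝ)).ne'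
          field_simp
      _ ≤ |C| * lam l x ξ ^ m₁ * (2 * lam l x ξ) ^ max m₂ 0 := by
          gcongr
          exact (Real.rpow_le_rpow_of_exponent_le (one_le_jap x) (le_max_left m₂ 0)).trans
            (Real.rpow_le_rpow hJ.le (jap_le_lam hl x ξ) (le_max_right m₂ 0))
      _ = _ := by
          rw [Real.mul_rpow (by norm_num) hL.le, Real.rpow_add hL]
          ring
  induction n generalizing a b with
  | zero => exact h0 a b
  | succ n ih =>
    refine ⟨h0 a b, fun x ξ => a * x ^ (a - 1) * ξ ^ b * partialXi^[b] (partialX^[a] g) x ξ +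
        x ^ a * ξ ^ b * partialXi^[b] (partialX^[a + 1] g) x ξ,
      fun x ξ => b * x ^ a * ξ ^ (b - 1) * partialXi^[b] (partialX^[a] g) x ξ +
        x ^ a * ξ ^ b * partialXi^[b + 1] (partialX^[a] g) x ξ, ?_, ?_, ?_⟩
    · convert ((ih a b).const_mul a).add (ih (a + 1) b) using 3 with x ξ
      rcases a with _ | a
      · simp; ring
      · simp only [Nat.add_sub_cancel]; ring
    · convert ((ih a b).const_mul b).add (ih a (b + 1)) using 3 with x ξ
      rcases b with _ | b
      · simp; ring
      · simp only [Nat.add_sub_cancel]; ring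
    · intro u v u' v' t hu hv
      have h := ((hu.pow a).mul (hv.pow b)).mul (hasDerivAt_comp_curve (hcd a b) hu hv)
      refine h.congr_deriv ?_
      rw [partialX_partialXi_iterate (contDiff_partialX_iterate hg.1 a) b,
        ← Function.iterate_succ_apply' partialX, ← Function.iterate_succ_apply' partialXi]
      simp only [Pi.pow_apply, Pi.mul_apply]
      ring

lemma IsSymbol.phaseSymbol {l m₁ m₂ : ℝ} (hl : 1 ≤ l) {g : ℝ → ℝ → ℝ}
    (hg : IsSymbol l m₁ m₂ g) (n : ℕ) : PhaseSymbol l (m₁ + max m₂ 0) n g := by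
  simpa using hg.phaseSymbol_monomial hl n 0 0

namespace GoodPotential

variable {l : ℝ} {V : ℝ → ℝ}

lemma hasDerivAt (hV : GoodPotential l V) (x : ℝ) : HasDerivAt V (deriv V x) x :=
  (hV.smooth.differentiable (by simp) x).hasDerivAt

lemma continuous_deriv (hV : GoodPotential l V) : Continuous (deriv V) :=
  hV.smooth.continuous_deriv (by simp)

lemma exists_lower_bounds (hl : 1 ≤ l) (hV : GoodPotential l V) :
    ∃ R : ℝ, 1 ≤ R ∧ ∀ x, R ≤ x → x ^ (2 * l) / 2 ≤ V x ∧ x ^ (2 * l - 1) ≤ deriv V x := by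
  obtain ⟨Vh, -, h⟩ := hV.expansion
  obtain ⟨C₀, R₀, h₀⟩ := h 0 0
  obtain ⟨C₁, R₁, h₁⟩ := h 0 1
  refine ⟨max 1 (max R₀ (max R₁ (2 * |C₀| + |C₁|))), le_max_left _ _, fun x hx => ?_⟩
  simp only [max_le_iff] at hx
  obtain ⟨hx1, hxR₀, hxR₁, hxC⟩ := hx
  have hx0 : 0 < x := by linarith
  have hxx : x ≤ x ^ 2 := by nlinarith
  have hC₀ := le_abs_self C₀
  have hC₁ := le_abs_self C₁
  have hC₀' := abs_nonneg C₀
  have hC₁' := abs_nonneg C₁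
  have e₀ := h₀ x (hxR₀.trans (le_abs_self x))
  have e₁ := h₁ x (hxR₁.trans (le_abs_self x))
  have hd : HasDerivAt (fun y => V y - |y| ^ (2 * l)) (deriv V x - 2 * l * x ^ (2 * l - 1)) x := by
    refine (hV.hasDerivAt x).sub ?_
    have := (hasDerivAt_id' x).rpow_const (p := 2 * l) (Or.inl hx0.ne')
    rw [one_mul] at this
    refine this.congr_of_eventuallyEq ?_
    filter_upwards [Ioi_mem_nhds hx0] with y hy
    rw [abs_of_pos hy]
  simp only [Finset.Icc_eq_empty_of_lt zero_lt_one, Finset.sum_empty, sub_zero,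
    iteratedDeriv_zero, iteratedDeriv_one, hd.deriv, abs_of_pos hx0] at e₀ e₁
  constructor
  · have hp := Real.rpow_pos_of_pos hx0 (2 * l - 2)
    have h2 : x ^ (2 * l) = x ^ (2 * l - 2) * x ^ 2 := by
      rw [← Real.rpow_natCast x 2, ← Real.rpow_add hx0]
      norm_num
    rw [show 2 * l - 2 * (((0 : ℕ) : ℝ) + 1) - ((0 : ℕ) : ℝ) = 2 * l - 2 by norm_num] at e₀
    have h3 := (abs_le.1 e₀).1
    have h4 : C₀ * x ^ (2 * l - 2) ≤ x ^ (2 * l - 2) * x ^ 2 / 2 := by nlinarith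
    linarith
  · have hp := Real.rpow_pos_of_pos hx0 (2 * l - 3)
    have h2 : x ^ (2 * l - 1) = x ^ (2 * l - 3) * x ^ 2 := by
      rw [← Real.rpow_natCast x 2, ← Real.rpow_add hx0]
      ring_nf
    rw [show 2 * l - 2 * (((0 : ℕ) : ℝ) + 1) - ((1 : ℕ) : ℝ) = 2 * l - 3 by norm_num; ring] at e₁
    have h3 := (abs_le.1 e₁).1
    have h4 : C₁ * x ^ (2 * l - 3) ≤ x ^ (2 * l - 3) * x ^ 2 := by nlinarith
    have h5 : 2 * x ^ (2 * l - 1) ≤ 2 * l * x ^ (2 * l - 1) := by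
      have := Real.rpow_pos_of_pos hx0 (2 * l - 1)
      nlinarith
    linarith

lemma deriv_pos (hl : 1 ≤ l) (hV : GoodPotential l V) {x : ℝ} (hx : 0 < x) : 0 < deriv V x := by
  obtain ⟨R, hR, h⟩ := hV.exists_lower_bounds hl
  by_contra! hneg
  have hR0 : 0 < R := by linarith
  have hpos : 0 ≤ deriv V R := (Real.rpow_nonneg hR0.le _).trans (h R le_rfl).2
  obtain ⟨z, hz, hz0⟩ := isPreconnected_Ioi.intermediate_value (Set.mem_Ioi.2 hx)
    (Set.mem_Ioi.2 hR0) hV.continuous_deriv.continuousOn ⟨hneg, hpos⟩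
  exact hV.deriv_ne z (ne_of_gt hz) hz0

lemma strictMonoOn (hl : 1 ≤ l) (hV : GoodPotential l V) : StrictMonoOn V (Set.Ici 0) :=
  strictMonoOn_of_deriv_pos (convex_Ici 0) hV.smooth.continuous.continuousOn fun x hx => by
    rw [interior_Ici] at hx
    exact hV.deriv_pos hl hx

lemma eq_abs (hV : GoodPotential l V) (x : ℝ) : V x = V |x| := by
  rcases abs_choice x with h | h <;> rw [h]
  exact (hV.even x).symm

lemma le_iff (hl : 1 ≤ l) (hV : GoodPotential l V) {x y : ℝ} (hy : 0 ≤ y) :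
    V x ≤ V y ↔ |x| ≤ y := by
  rw [hV.eq_abs x]
  exact (hV.strictMonoOn hl).le_iff_le (abs_nonneg x) hy

lemma zero_le (hl : 1 ≤ l) (hV : GoodPotential l V) (x : ℝ) : V 0 ≤ V x := by
  rw [hV.eq_abs x]
  exact (hV.strictMonoOn hl).monotoneOn Set.self_mem_Ici (abs_nonneg x) (abs_nonneg x)

lemma exists_le_weight (hl : 1 ≤ l) (hV : GoodPotential l V) :
    ∃ C : ℝ, 0 < C ∧ ∀ x, V x - V 0 ≤ C * (1 + |x| ^ (2 * l)) := by
  obtain ⟨C, hC⟩ := hV.growth 0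
  refine ⟨|C| * 2 ^ l + |V 0| + 1, by positivity, fun x => ?_⟩
  have h1 := hC x
  simp only [iteratedDeriv_zero, Nat.cast_zero, sub_zero] at h1
  have h2 := jap_rpow_le hl x
  have h3 : 0 ≤ |x| ^ (2 * l) := by positivity
  have h4 : C * jap x ^ (2 * l) ≤ |C| * (2 ^ l * (1 + |x| ^ (2 * l))) := by
    have : 0 ≤ jap x ^ (2 * l) := Real.rpow_nonneg (jap_pos x).le _
    exact mul_le_mul (le_abs_self C) h2 this (abs_nonneg C)
  nlinarith [le_abs_self (V x), neg_abs_le (V 0), abs_nonneg (V 0)]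

lemma exists_weight_le (hl : 1 ≤ l) (hV : GoodPotential l V) :
    ∃ C : ℝ, 0 < C ∧ ∀ x, 1 + |x| ^ (2 * l) ≤ C * (1 + (V x - V 0)) := by
  obtain ⟨R, hR, h⟩ := hV.exists_lower_bounds hl
  have hRl : 0 ≤ R ^ (2 * l) := Real.rpow_nonneg (by linarith) _
  refine ⟨3 + R ^ (2 * l) + 2 * |V 0|, by positivity, fun x => ?_⟩
  have h0 := hV.zero_le hl x
  have h1 := abs_nonneg (V 0)
  rcases le_total |x| R with hx | hx
  · have : |x| ^ (2 * l) ≤ R ^ (2 * l) :=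
      Real.rpow_le_rpow (abs_nonneg x) hx (by linarith)
    nlinarith
  · have := (h |x| hx).1
    rw [← hV.eq_abs x] at this
    nlinarith [le_abs_self (V 0)]

lemma exists_le_mul_deriv (hl : 1 ≤ l) (hV : GoodPotential l V) {x₁ : ℝ} (hx₁ : 0 < x₁) :
    ∃ c : ℝ, 0 < c ∧ ∀ x, x₁ ≤ x → c * (V x - V 0) ≤ x * deriv V x := by
  obtain ⟨R, hR, h⟩ := hV.exists_lower_bounds hl
  obtain ⟨C, hC, hw⟩ := hV.exists_le_weight hl
  have hne : (Set.Icc x₁ (max x₁ R)).Nonempty := ⟨x₁, le_rfl, le_max_left _ _⟩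
  obtain ⟨z, hz, hmin⟩ := isCompact_Icc.exists_isMinOn hne
    (continuous_id.mul hV.continuous_deriv).continuousOn
  have hz0 : 0 < z := hx₁.trans_le hz.1
  have hδ : 0 < z * deriv V z := mul_pos hz0 (hV.deriv_pos hl hz0)
  set M := V (max x₁ R) - V 0 with hM
  have hMpos : 0 < M := sub_pos.2 <| (hV.strictMonoOn hl) Set.self_mem_Ici
    (le_max_of_le_left hx₁.le : (0 : ℝ) ≤ max x₁ R) (lt_max_of_lt_left hx₁)
  refine ⟨min (z * deriv V z / M) (1 / (2 * C)), lt_min (by positivity) (by positivity),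
    fun x hx => ?_⟩
  have hx0 : 0 < x := hx₁.trans_le hx
  have hU := sub_nonneg.2 (hV.zero_le hl x)
  rcases le_total x (max x₁ R) with hxR | hxR
  · have h1 : z * deriv V z ≤ x * deriv V x := hmin ⟨hx, hxR⟩
    have h2 : V x - V 0 ≤ M := by
      have := (hV.le_iff hl (le_max_of_le_left hx₁.le : (0 : ℝ) ≤ max x₁ R)).2
        (by rwa [abs_of_pos hx0] : |x| ≤ max x₁ R)
      linarith
    calc _ ≤ z * deriv V z / M * (V x - V 0) := by gcongr; exact min_le_left _ _
      _ ≤ z * deriv V z / M * M := by gcongr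
      _ = z * deriv V z := by field_simp
      _ ≤ _ := h1
  · have hxR' : R ≤ x := (le_max_right _ _).trans hxR
    have h1 := hw x
    rw [abs_of_pos hx0] at h1
    have h2 : 1 ≤ x ^ (2 * l) := Real.one_le_rpow (by linarith) (by linarith)
    calc _ ≤ 1 / (2 * C) * (V x - V 0) := by gcongr; exact min_le_right _ _
      _ ≤ 1 / (2 * C) * (C * (1 + x ^ (2 * l))) := by gcongr
      _ ≤ 1 / (2 * C) * (C * (2 * x ^ (2 * l))) := by gcongr; linarith
      _ = x * x ^ (2 * l - 1) := by
        rw [Real.rpow_sub_one hx0.ne']; field_simp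
      _ ≤ _ := by gcongr; exact (h x hxR').2

lemma isSymbol (hV : GoodPotential l V) : IsSymbol l 0 (2 * l) (fun x _ => V x) := by
  refine ⟨hV.smooth.comp contDiff_fst, fun k₁ k₂ => ?_⟩
  rcases k₁ with _ | k₁
  · obtain ⟨C, hC⟩ := hV.growth k₂
    exact ⟨C, fun x ξ => by simpa using hC x⟩
  · exact ⟨0, fun x ξ => by simp [iteratedDeriv_const]⟩

end GoodPotential

/-- The turning point as a function of the energy above the bottom of the well. -/
def wellRadius (V qM : ℝ → ℝ) (e : ℝ) : ℝ := qM (V 0 + e)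

section WellRadius

variable {l : ℝ} {V qM : ℝ → ℝ}

lemma wellRadius_pos (hqM : IsTurningPoint V qM) {e : ℝ} (he : 0 < e) : 0 < wellRadius V qM e :=
  (hqM _ (by linarith)).1

lemma potential_wellRadius (hqM : IsTurningPoint V qM) {e : ℝ} (he : 0 < e) :
    V (wellRadius V qM e) = V 0 + e :=
  (hqM _ (by linarith)).2.1

lemma wellRadius_potential (hl : 1 ≤ l) (hV : GoodPotential l V) (hqM : IsTurningPoint V qM)
    {x : ℝ} (hx : 0 < x) : wellRadius V qM (V x - V 0) = x := by
  have h := hV.strictMonoOn hl Set.self_mem_Ici (Set.mem_Ici.2 hx.le) hx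
  rw [wellRadius, add_sub_cancel]
  exact ((hqM _ h).2.2 x hx rfl).symm

lemma wellRadius_strictMonoOn (hl : 1 ≤ l) (hV : GoodPotential l V) (hqM : IsTurningPoint V qM) :
    StrictMonoOn (wellRadius V qM) (Set.Ioi 0) := by
  intro a ha b hb hab
  rw [← (hV.strictMonoOn hl).lt_iff_lt (wellRadius_pos hqM ha).le (wellRadius_pos hqM hb).le,
    potential_wellRadius hqM ha, potential_wellRadius hqM hb]
  linarith

lemma wellRadius_continuousAt (hl : 1 ≤ l) (hV : GoodPotential l V) (hqM : IsTurningPoint V qM)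
    {e : ℝ} (he : 0 < e) : ContinuousAt (wellRadius V qM) e := by
  refine continuousAt_of_monotoneOn_of_image_mem_nhds
    (wellRadius_strictMonoOn hl hV hqM).monotoneOn (Ioi_mem_nhds he) ?_
  refine Filter.mem_of_superset (Ioi_mem_nhds (wellRadius_pos hqM he)) fun x hx => ?_
  exact ⟨V x - V 0, sub_pos.2 (hV.strictMonoOn hl Set.self_mem_Ici (Set.mem_Ici.2 hx.le) hx),
    wellRadius_potential hl hV hqM hx⟩

lemma hasDerivAt_wellRadius (hl : 1 ≤ l) (hV : GoodPotential l V) (hqM : IsTurningPoint V qM)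
    {e : ℝ} (he : 0 < e) :
    HasDerivAt (wellRadius V qM) (deriv V (wellRadius V qM e))⁻¹ e := by
  refine HasDerivAt.of_local_left_inverse (f := fun x => V x - V 0)
    (wellRadius_continuousAt hl hV hqM he) ((hV.hasDerivAt _).sub_const _)
    (hV.deriv_pos hl (wellRadius_pos hqM he)).ne' ?_
  filter_upwards [Ioi_mem_nhds he] with y hy
  rw [potential_wellRadius hqM hy]
  ring

end WellRadius

section Radial

variable {l : ℝ} {V qM c : ℝ → ℝ}

lemma ExpSymbol.comp_potential {τ₀ : ℝ} {n : ℕ} {x α : ℝ → ℝ → ℝ} (hl : 1 ≤ l)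
    (hV : GoodPotential l V) (hx : Continuous (fun q : ℝ × ℝ => x q.1 q.2))
    (hα : ∀ k < n, ExpSymbol τ₀ k 0 α)
    (hdx : ∀ τ s, HasDerivAt (fun t => x t s) (α τ s * x τ s) τ)
    (hw : ∃ C : ℝ, ∀ τ s, τ₀ ≤ τ → 1 + |x τ s| ^ (2 * l) ≤ C * Real.exp τ) :
    ExpSymbol τ₀ n 1 (fun τ s => V (x τ s)) ∧
      ExpSymbol τ₀ n 1 (fun τ s => x τ s * deriv V (x τ s)) := by
  have hm : (0 : ℝ) + max (2 * l) 0 = 2 * l := by rw [zero_add, max_eq_left (by linarith)]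
  have h1 := hV.isSymbol.phaseSymbol hl n
  have h2 := hV.isSymbol.phaseSymbol_monomial hl n 1 0
  rw [hm] at h1 h2
  have hw' : ∃ C : ℝ, ∀ τ s : ℝ, τ₀ ≤ τ → lam l (x τ s) 0 ^ (2 * l) ≤ C * Real.exp (1 * τ) := by
    obtain ⟨C, hC⟩ := hw
    refine ⟨C, fun τ s hτ => ?_⟩
    rw [lam_rpow, div_self (by linarith), Real.rpow_one]
    simpa using hC τ s hτ
  have hd0 : ∀ τ s : ℝ, HasDerivAt (fun t => (fun _ _ => 0 : ℝ → ℝ → ℝ) t s)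
      ((fun _ _ => 0 : ℝ → ℝ → ℝ) τ s * 0) τ := fun τ s => by simpa using hasDerivAt_const τ (0 : ℝ)
  have h0 := fun k (_ : k < n) => ExpSymbol.const τ₀ k 0
  refine ⟨ExpSymbol.comp_phaseSymbol h1 hx continuous_const hα h0 hdx hd0 hw', ?_⟩
  simpa [partialX] using ExpSymbol.comp_phaseSymbol h2 hx continuous_const hα h0 hdx hd0 hw'

/-- The logarithmic derivative in `τ` of `wellRadius V qM (c s * exp τ)`. -/
def radialRate (V qM c : ℝ → ℝ) (τ s : ℝ) : ℝ :=
  c s * Real.exp τ * (wellRadius V qM (c s * Real.exp τ) *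
    deriv V (wellRadius V qM (c s * Real.exp τ)))⁻¹

lemma hasDerivAt_radial (hl : 1 ≤ l) (hV : GoodPotential l V) (hqM : IsTurningPoint V qM)
    (hc : ∀ s, 1 / 2 ≤ c s) (τ s : ℝ) :
    HasDerivAt (fun t => wellRadius V qM (c s * Real.exp t))
      (radialRate V qM c τ s * wellRadius V qM (c s * Real.exp τ)) τ := by
  have he : 0 < c s * Real.exp τ := mul_pos (by linarith [hc s]) (Real.exp_pos τ)
  refine ((hasDerivAt_wellRadius hl hV hqM he).comp τ
    ((Real.hasDerivAt_exp τ).const_mul (c s))).congr_deriv ?_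
  have := (wellRadius_pos hqM he).ne'
  rw [radialRate]
  field_simp

lemma continuous_radial (hl : 1 ≤ l) (hV : GoodPotential l V) (hqM : IsTurningPoint V qM)
    (hcc : Continuous c) (hc : ∀ s, 1 / 2 ≤ c s) :
    Continuous (fun q : ℝ × ℝ => wellRadius V qM (c q.2 * Real.exp q.1)) := by
  refine continuous_iff_continuousAt.2 fun q => ?_
  have he : 0 < c q.2 * Real.exp q.1 := mul_pos (by linarith [hc q.2]) (Real.exp_pos _)
  exact ContinuousAt.comp (f := fun q : ℝ × ℝ => c q.2 * Real.exp q.1)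
    (wellRadius_continuousAt hl hV hqM he) (by fun_prop)

lemma radial_weight_le (hl : 1 ≤ l) (hV : GoodPotential l V) (hqM : IsTurningPoint V qM)
    (hc : ∀ s, 1 / 2 ≤ c s) (hc1 : ∀ s, c s ≤ 1) (τ₀ : ℝ) :
    ∃ C : ℝ, 0 < C ∧ ∀ τ s, τ₀ ≤ τ →
      1 + wellRadius V qM (c s * Real.exp τ) ^ (2 * l) ≤ C * Real.exp τ := by
  obtain ⟨C, hC, hw⟩ := hV.exists_weight_le hl
  refine ⟨C * (Real.exp (-τ₀) + 1), by positivity, fun τ s hτ => ?_⟩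
  have hE := Real.exp_pos τ
  have he : 0 < c s * Real.exp τ := mul_pos (by linarith [hc s]) hE
  have h := hw (wellRadius V qM (c s * Real.exp τ))
  rw [abs_of_pos (wellRadius_pos hqM he), potential_wellRadius hqM he] at h
  have h1 : 1 ≤ Real.exp (-τ₀) * Real.exp τ := by
    rw [← Real.exp_add]
    exact Real.one_le_exp (by linarith)
  have h2 : c s * Real.exp τ ≤ Real.exp τ := by nlinarith [hc1 s]
  refine h.trans ?_
  rw [mul_assoc]
  gcongr
  linarith

lemma le_radial_weight (hl : 1 ≤ l) (hV : GoodPotential l V) (hqM : IsTurningPoint V qM)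
    (hc : ∀ s, 1 / 2 ≤ c s) (τ₀ : ℝ) :
    ∃ δ : ℝ, 0 < δ ∧ ∀ τ s, τ₀ ≤ τ →
      δ * Real.exp τ ≤ wellRadius V qM (c s * Real.exp τ) ^ (2 * l) := by
  obtain ⟨C, hC, hw⟩ := hV.exists_le_weight hl
  set r := wellRadius V qM (1 / 2 * Real.exp τ₀) with hr
  have hE₀ : (0 : ℝ) < 1 / 2 * Real.exp τ₀ := by positivity
  have hr0 : 0 < r := wellRadius_pos hqM hE₀
  have hrl := Real.rpow_pos_of_pos hr0 (2 * l)
  refine ⟨(2 * C * ((r ^ (2 * l))⁻¹ + 1))⁻¹, by positivity, fun τ s hτ => ?_⟩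
  have hE := Real.exp_pos τ
  have he : 0 < c s * Real.exp τ := mul_pos (by linarith [hc s]) hE
  have hy := wellRadius_pos hqM he
  have h := hw (wellRadius V qM (c s * Real.exp τ))
  rw [abs_of_pos hy, potential_wellRadius hqM he] at h
  have hry : r ≤ wellRadius V qM (c s * Real.exp τ) := by
    refine (wellRadius_strictMonoOn hl hV hqM).monotoneOn hE₀ he ?_
    exact mul_le_mul (hc s) (Real.exp_le_exp.2 hτ) (Real.exp_pos _).le (by linarith [hc s])
  have hryl : r ^ (2 * l) ≤ wellRadius V qM (c s * Real.exp τ) ^ (2 * l) :=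
    Real.rpow_le_rpow hr0.le hry (by linarith)
  set Y := wellRadius V qM (c s * Real.exp τ) ^ (2 * l)
  have h1 : 1 ≤ (r ^ (2 * l))⁻¹ * Y := by
    rw [inv_mul_eq_div, one_le_div hrl]
    exact hryl
  rw [inv_mul_le_iff₀ (by positivity)]
  have h2 : Real.exp τ ≤ 2 * (c s * Real.exp τ) := by nlinarith [hc s]
  calc Real.exp τ ≤ 2 * (C * (1 + Y)) := by linarith
    _ ≤ 2 * (C * ((r ^ (2 * l))⁻¹ * Y + Y)) := by gcongr
    _ = _ := by ring

lemma le_radial_mul_deriv (hl : 1 ≤ l) (hV : GoodPotential l V) (hqM : IsTurningPoint V qM)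
    (hc : ∀ s, 1 / 2 ≤ c s) (τ₀ : ℝ) :
    ∃ δ : ℝ, 0 < δ ∧ ∀ τ s, τ₀ ≤ τ →
      δ * (c s * Real.exp τ) ≤ wellRadius V qM (c s * Real.exp τ) *
        deriv V (wellRadius V qM (c s * Real.exp τ)) := by
  have hE₀ : (0 : ℝ) < 1 / 2 * Real.exp τ₀ := by positivity
  obtain ⟨δ, hδ, h⟩ := hV.exists_le_mul_deriv hl (wellRadius_pos hqM hE₀)
  refine ⟨δ, hδ, fun τ s hτ => ?_⟩
  have he : 0 < c s * Real.exp τ := mul_pos (by linarith [hc s]) (Real.exp_pos τ)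
  have hry : wellRadius V qM (1 / 2 * Real.exp τ₀) ≤ wellRadius V qM (c s * Real.exp τ) := by
    refine (wellRadius_strictMonoOn hl hV hqM).monotoneOn hE₀ he ?_
    exact mul_le_mul (hc s) (Real.exp_le_exp.2 hτ) (Real.exp_pos _).le (by linarith [hc s])
  have := h _ hry
  rwa [potential_wellRadius hqM he, add_sub_cancel_left] at this

lemma radial_mul_deriv_pos (hl : 1 ≤ l) (hV : GoodPotential l V) (hqM : IsTurningPoint V qM)
    (hc : ∀ s, 1 / 2 ≤ c s) (τ s : ℝ) :
    0 < wellRadius V qM (c s * Real.exp τ) * deriv V (wellRadius V qM (c s * Real.exp τ)) := by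
  have he : 0 < c s * Real.exp τ := mul_pos (by linarith [hc s]) (Real.exp_pos τ)
  exact mul_pos (wellRadius_pos hqM he) (hV.deriv_pos hl (wellRadius_pos hqM he))

lemma expSymbol_radialRate (hl : 1 ≤ l) (hV : GoodPotential l V) (hqM : IsTurningPoint V qM)
    (hcc : Continuous c) (hc : ∀ s, 1 / 2 ≤ c s) (hc1 : ∀ s, c s ≤ 1) (τ₀ : ℝ) (n : ℕ) :
    ExpSymbol τ₀ n 0 (radialRate V qM c) ∧
      ExpSymbol τ₀ n (-1) (fun τ s => (wellRadius V qM (c s * Real.exp τ) *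
        deriv V (wellRadius V qM (c s * Real.exp τ)))⁻¹) := by
  obtain ⟨δ, hδ, hlow⟩ := le_radial_mul_deriv hl hV hqM hc τ₀
  obtain ⟨C, hC, hup⟩ := radial_weight_le hl hV hqM hc hc1 τ₀
  have hdpos := radial_mul_deriv_pos hl hV hqM hc
  have hlow' : ∀ τ s, τ₀ ≤ τ → δ / 2 * Real.exp (1 * τ) ≤ wellRadius V qM (c s * Real.exp τ) *
      deriv V (wellRadius V qM (c s * Real.exp τ)) := fun τ s hτ => by
    refine le_trans ?_ (hlow τ s hτ)
    rw [one_mul, div_mul_eq_mul_div, mul_div_assoc]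
    gcongr
    linarith [mul_le_mul_of_nonneg_right (hc s) (Real.exp_pos τ).le]
  have hstep : ∀ n, (∀ k < n, ExpSymbol τ₀ k 0 (radialRate V qM c)) →
      ExpSymbol τ₀ n (-1) (fun τ s => (wellRadius V qM (c s * Real.exp τ) *
        deriv V (wellRadius V qM (c s * Real.exp τ)))⁻¹) := by
    intro n hα
    refine (ExpSymbol.comp_potential hl hV (continuous_radial hl hV hqM hcc hc) hα
      (hasDerivAt_radial hl hV hqM hc) ⟨C, fun τ s hτ => ?_⟩).2.inv hdpos (half_pos hδ) hlow'
    rw [abs_of_pos (wellRadius_pos hqM (mul_pos (by linarith [hc s]) (Real.exp_pos τ)))]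
    exact hup τ s hτ
  have hfin : ∀ n, ExpSymbol τ₀ n (-1) (fun τ s => (wellRadius V qM (c s * Real.exp τ) *
        deriv V (wellRadius V qM (c s * Real.exp τ)))⁻¹) →
      ExpSymbol τ₀ n 0 (radialRate V qM c) := by
    intro n h
    have hcb : ∀ s, |c s| ≤ 1 := fun s => abs_le.2 ⟨by linarith [hc s], hc1 s⟩
    have := ((ExpSymbol.of_continuous_bounded τ₀ n hcc hcb).mul (ExpSymbol.exp τ₀ n 1)).mul h
    simp only [one_mul, zero_add, add_neg_cancel] at this
    exact this
  have hall : ∀ n, ExpSymbol τ₀ n 0 (radialRate V qM c) := by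
    intro n
    induction n using Nat.strong_induction_on with
    | _ n ih => exact hfin n (hstep n ih)
  exact ⟨hall n, hstep n fun k _ => hall k⟩

lemma expSymbol_radial (hl : 1 ≤ l) (hV : GoodPotential l V) (hqM : IsTurningPoint V qM)
    (hcc : Continuous c) (hc : ∀ s, 1 / 2 ≤ c s) (hc1 : ∀ s, c s ≤ 1) (τ₀ : ℝ) (n : ℕ) :
    ExpSymbol τ₀ n (1 / (2 * l)) (fun τ s => wellRadius V qM (c s * Real.exp τ)) := by
  obtain ⟨C, hC, hup⟩ := radial_weight_le hl hV hqM hc hc1 τ₀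
  refine ExpSymbol.of_logDeriv
    (fun k _ => (expSymbol_radialRate hl hV hqM hcc hc hc1 τ₀ k).1)
    ⟨continuous_radial hl hV hqM hcc hc, C ^ (1 / (2 * l)), fun τ s hτ => ?_⟩
    (hasDerivAt_radial hl hV hqM hc)
  have hy := wellRadius_pos hqM (mul_pos (by linarith [hc s] : 0 < c s) (Real.exp_pos τ))
  have h1 : wellRadius V qM (c s * Real.exp τ) ^ (2 * l) ≤ C * Real.exp τ := by
    linarith [hup τ s hτ]
  have h2 := Real.rpow_le_rpow (by positivity) h1 (by positivity : 0 ≤ 1 / (2 * l))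
  rw [← Real.rpow_mul hy.le, mul_one_div_cancel (by linarith), Real.rpow_one,
    Real.mul_rpow hC.le (Real.exp_pos τ).le, ← Real.exp_mul, mul_comm τ] at h2
  rwa [abs_of_pos hy]

end Radial

/-- The retraction of `ℝ` onto `[-1, 1]`. -/
def unitClamp (s : ℝ) : ℝ := max (-1) (min 1 s)

lemma continuous_unitClamp : Continuous unitClamp := by
  unfold unitClamp
  fun_prop

lemma abs_unitClamp_le (s : ℝ) : |unitClamp s| ≤ 1 :=
  abs_le.2 ⟨le_max_left _ _, max_le (by norm_num) (min_le_left _ _)⟩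

lemma unitClamp_of_mem {s : ℝ} (hs : s ∈ Set.Icc (-1 : ℝ) 1) : unitClamp s = s := by
  rw [unitClamp, min_eq_right hs.2, max_eq_right hs.1]

lemma unitClamp_sq_le (s : ℝ) : unitClamp s ^ 2 ≤ 1 := by
  rw [← sq_abs]
  exact pow_le_one₀ (abs_nonneg _) (abs_unitClamp_le s)

section Arcs

variable {l : ℝ} {V qM : ℝ → ℝ}

lemma exists_lam_rpow_le (hl : 1 ≤ l) (hV : GoodPotential l V) (m τ₀ : ℝ) :
    ∃ C : ℝ, ∀ x ξ τ, τ₀ ≤ τ → ξ ^ 2 + (V x - V 0) = Real.exp τ →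
      lam l x ξ ^ m ≤ C * Real.exp (m / (2 * l) * τ) := by
  obtain ⟨C, hC, h₁⟩ := hV.exists_le_weight hl
  obtain ⟨D, hD, h₂⟩ := hV.exists_weight_le hl
  refine ⟨((C + 1)⁻¹) ^ (m / (2 * l)) + ((D + 1) * (Real.exp (-τ₀) + 1)) ^ (m / (2 * l)),
    fun x ξ τ hτ he => ?_⟩
  have hU := sub_nonneg.2 (hV.zero_le hl x)
  have hx : 0 ≤ |x| ^ (2 * l) := by positivity
  have hE : 1 ≤ Real.exp (-τ₀) * Real.exp τ := by
    rw [← Real.exp_add]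
    exact Real.one_le_exp (by linarith)
  rw [lam_rpow, mul_comm (m / (2 * l)) τ, Real.exp_mul]
  refine rpow_le_of_comparable (by positivity) (Real.exp_pos τ) ?_ ?_ _
  · rw [inv_mul_le_iff₀ (by positivity), ← he]
    nlinarith [h₁ x, sq_nonneg ξ]
  · have h3 : 1 + ξ ^ 2 + |x| ^ (2 * l) ≤ (D + 1) * (1 + Real.exp τ) := by
      rw [← he]
      nlinarith [h₂ x, sq_nonneg ξ]
    refine h3.trans ?_
    rw [mul_assoc]
    gcongr
    linarith

/-- The part of the energy curve lying over the middle of the well, as a family of integrands. -/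
def innerArc (V qM : ℝ → ℝ) (f : ℝ → ℝ → ℝ) (ε τ s : ℝ) : ℝ :=
  f (wellRadius V qM (1 / 2 * Real.exp τ) * unitClamp s)
      (ε * √(Real.exp τ - (V (wellRadius V qM (1 / 2 * Real.exp τ) * unitClamp s) - V 0))) *
    (√(Real.exp τ - (V (wellRadius V qM (1 / 2 * Real.exp τ) * unitClamp s) - V 0)))⁻¹ *
    wellRadius V qM (1 / 2 * Real.exp τ)

/-- The part of the energy curve near a turning point, as a family of integrands. -/
def outerArc (V qM : ℝ → ℝ) (f : ℝ → ℝ → ℝ) (ε τ s : ℝ) : ℝ :=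
  f (ε * wellRadius V qM ((1 - unitClamp s ^ 2 / 2) * Real.exp τ))
      (√(1 / 2 * Real.exp τ) * unitClamp s) *
    (2 * √(1 / 2 * Real.exp τ) *
      (deriv V (wellRadius V qM ((1 - unitClamp s ^ 2 / 2) * Real.exp τ)))⁻¹)

lemma inner_gap (hl : 1 ≤ l) (hV : GoodPotential l V) (hqM : IsTurningPoint V qM) (τ s : ℝ) :
    1 / 2 * Real.exp τ ≤
      Real.exp τ - (V (wellRadius V qM (1 / 2 * Real.exp τ) * unitClamp s) - V 0) := by
  have he : 0 < 1 / 2 * Real.exp τ := by positivity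
  have hy := wellRadius_pos hqM he
  have h : V (wellRadius V qM (1 / 2 * Real.exp τ) * unitClamp s) ≤
      V (wellRadius V qM (1 / 2 * Real.exp τ)) := by
    rw [hV.le_iff hl hy.le, abs_mul, abs_of_pos hy]
    exact mul_le_of_le_one_right hy.le (abs_unitClamp_le s)
  rw [potential_wellRadius hqM he] at h
  linarith

lemma expSymbol_innerArc (hl : 1 ≤ l) (hV : GoodPotential l V) (hqM : IsTurningPoint V qM)
    {m : ℝ} {n : ℕ} {f : ℝ → ℝ → ℝ} (hf : PhaseSymbol l m n f) {ε : ℝ} (hε : ε ^ 2 = 1) (τ₀ : ℝ) :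
    ExpSymbol τ₀ n (m / (2 * l) + (1 / (2 * l) - 1 / 2)) (innerArc V qM f ε) := by
  have hc : ∀ s : ℝ, (1 : ℝ) / 2 ≤ (fun _ => 1 / 2 : ℝ → ℝ) s := fun _ => le_rfl
  have hc1 : ∀ s : ℝ, (fun _ => 1 / 2 : ℝ → ℝ) s ≤ 1 := fun _ => by norm_num
  have hcc : Continuous (fun _ => 1 / 2 : ℝ → ℝ) := continuous_const
  have hα := fun n => (expSymbol_radialRate hl hV hqM hcc hc hc1 τ₀ n).1
  have hY := expSymbol_radial hl hV hqM hcc hc hc1 τ₀ n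
  have hYd := hasDerivAt_radial hl hV hqM hc
  have hYc := continuous_radial hl hV hqM hcc hc
  obtain ⟨C, hC, hYw⟩ := radial_weight_le hl hV hqM hc hc1 τ₀
  set α := radialRate V qM (fun _ => 1 / 2)
  set x : ℝ → ℝ → ℝ := fun τ s => wellRadius V qM (1 / 2 * Real.exp τ) * unitClamp s with hx
  set A : ℝ → ℝ → ℝ := fun τ s => Real.exp τ - (V (x τ s) - V 0) with hA
  have hgap : ∀ τ s, 1 / 2 * Real.exp τ ≤ A τ s := inner_gap hl hV hqM
  have hApos : ∀ τ s, 0 < A τ s := fun τ s => lt_of_lt_of_le (by positivity) (hgap τ s)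
  have hxc : Continuous (fun q : ℝ × ℝ => x q.1 q.2) :=
    hYc.mul (continuous_unitClamp.comp continuous_snd)
  have hxd : ∀ τ s, HasDerivAt (fun t => x t s) (α τ s * x τ s) τ := fun τ s =>
    ((hYd τ s).mul_const (unitClamp s)).congr_deriv (by simp only [hx]; ring)
  have hxw : ∃ C : ℝ, ∀ τ s, τ₀ ≤ τ → 1 + |x τ s| ^ (2 * l) ≤ C * Real.exp τ := by
    refine ⟨C, fun τ s hτ => le_trans ?_ (hYw τ s hτ)⟩
    have hy := wellRadius_pos hqM (by positivity : 0 < 1 / 2 * Real.exp τ)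
    have : |x τ s| ≤ wellRadius V qM (1 / 2 * Real.exp τ) := by
      rw [hx, abs_mul, abs_of_pos hy]
      exact mul_le_of_le_one_right hy.le (abs_unitClamp_le s)
    gcongr
  have hVx := fun n => ExpSymbol.comp_potential hl hV hxc (fun k (_ : k < n) => hα k) hxd hxw
  have hAs : ∀ n, ExpSymbol τ₀ n 1 A := fun n => by
    have h := (ExpSymbol.exp τ₀ n 1).sub
      ((hVx n).1.sub ((ExpSymbol.const τ₀ n (V 0)).mono zero_le_one))
    simpa only [one_mul] using h
  have hlow : ∀ τ s, τ₀ ≤ τ → 1 / 2 * Real.exp (1 * τ) ≤ A τ s := fun τ s _ => by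
    rw [one_mul]
    exact hgap τ s
  have hAi := fun n => (hAs n).inv hApos (by norm_num) hlow
  have hAr := (hAs n).rpow hApos (by norm_num) hlow (-(1 / 2))
  set β : ℝ → ℝ → ℝ := fun τ s =>
    1 / 2 * ((Real.exp τ - α τ s * (x τ s * deriv V (x τ s))) * (A τ s)⁻¹) with hβ
  have hβs : ∀ n, ExpSymbol τ₀ n 0 β := fun n => by
    have h1 := (hα n).mul (hVx n).2
    rw [zero_add] at h1
    have h := (((ExpSymbol.exp τ₀ n 1).sub h1).mul (hAi n)).const_mul (1 / 2)
    simpa only [one_mul, add_neg_cancel] using h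
  set ξ : ℝ → ℝ → ℝ := fun τ s => ε * √(A τ s) with hξ
  have hξc : Continuous (fun q : ℝ × ℝ => ξ q.1 q.2) :=
    continuous_const.mul (hAs 0).continuous.sqrt
  have hξd : ∀ τ s, HasDerivAt (fun t => ξ t s) (β τ s * ξ τ s) τ := by
    intro τ s
    have h1 : HasDerivAt (fun t => A t s)
        (Real.exp τ - α τ s * (x τ s * deriv V (x τ s))) τ := by
      refine ((Real.hasDerivAt_exp τ).sub
        (((hV.hasDerivAt (x τ s)).comp τ (hxd τ s)).sub_const (V 0))).congr_deriv ?_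
      ring
    refine ((h1.sqrt (hApos τ s).ne').const_mul ε).congr_deriv ?_
    have h2 : √(A τ s) * √(A τ s) = A τ s := Real.mul_self_sqrt (hApos τ s).le
    have h3 : √(A τ s) ≠ 0 := (Real.sqrt_pos.2 (hApos τ s)).ne'
    simp only [hβ, hξ]
    rw [← h2]
    simp only [Real.sqrt_mul_self (Real.sqrt_nonneg _)]
    field_simp
  have hlam : ∃ C : ℝ, ∀ τ s, τ₀ ≤ τ →
      lam l (x τ s) (ξ τ s) ^ m ≤ C * Real.exp (m / (2 * l) * τ) := by
    obtain ⟨C, hC⟩ := exists_lam_rpow_le hl hV m τ₀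
    refine ⟨C, fun τ s hτ => hC _ _ τ hτ ?_⟩
    rw [hξ, mul_pow, hε, one_mul, Real.sq_sqrt (hApos τ s).le, hA]
    ring
  have hfs := ExpSymbol.comp_phaseSymbol hf hxc hξc (fun k _ => hα k) (fun k _ => hβs k)
    hxd hξd hlam
  have h := (hfs.mul hAr).mul hY
  convert h using 1
  · ring
  · funext τ s
    rw [Real.rpow_neg (hApos τ s).le, ← Real.sqrt_eq_rpow]
    rfl

lemma outer_coeff_mem (s : ℝ) :
    1 / 2 ≤ 1 - unitClamp s ^ 2 / 2 ∧ 1 - unitClamp s ^ 2 / 2 ≤ 1 := by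
  constructor <;> linarith [unitClamp_sq_le s, sq_nonneg (unitClamp s)]

lemma expSymbol_outerArc (hl : 1 ≤ l) (hV : GoodPotential l V) (hqM : IsTurningPoint V qM)
    {m : ℝ} {n : ℕ} {f : ℝ → ℝ → ℝ} (hf : PhaseSymbol l m n f) {ε : ℝ} (hε : ε ^ 2 = 1) (τ₀ : ℝ) :
    ExpSymbol τ₀ n (m / (2 * l) + (1 / (2 * l) - 1 / 2)) (outerArc V qM f ε) := by
  set c : ℝ → ℝ := fun s => 1 - unitClamp s ^ 2 / 2 with hcdef
  have hc : ∀ s : ℝ, (1 : ℝ) / 2 ≤ c s := fun s => (outer_coeff_mem s).1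
  have hc1 : ∀ s : ℝ, c s ≤ 1 := fun s => (outer_coeff_mem s).2
  have hcc : Continuous c := by
    have := continuous_unitClamp
    fun_prop
  have hα := fun n => (expSymbol_radialRate hl hV hqM hcc hc hc1 τ₀ n).1
  have hD := (expSymbol_radialRate hl hV hqM hcc hc hc1 τ₀ n).2
  have hY := expSymbol_radial hl hV hqM hcc hc hc1 τ₀ n
  have hYd := hasDerivAt_radial hl hV hqM hc
  have hYc := continuous_radial hl hV hqM hcc hc
  have hYpos : ∀ τ s, 0 < wellRadius V qM (c s * Real.exp τ) := fun τ s =>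
    wellRadius_pos hqM (mul_pos (by linarith [hc s]) (Real.exp_pos τ))
  have hwpos : ∀ τ s : ℝ, 0 < (fun τ _ => 1 / 2 * Real.exp τ : ℝ → ℝ → ℝ) τ s :=
    fun τ s => by positivity
  have hW : ExpSymbol τ₀ n (1 / 2) (fun τ _ => √(1 / 2 * Real.exp τ)) := by
    have h := (ExpSymbol.exp τ₀ n 1).const_mul (1 / 2)
    simp only [one_mul] at h
    exact h.sqrt hwpos (c := 1 / 2) (by norm_num) fun τ s _ => by simp
  have hxd : ∀ τ s, HasDerivAt (fun t => ε * wellRadius V qM (c s * Real.exp t))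
      (radialRate V qM c τ s * (ε * wellRadius V qM (c s * Real.exp τ))) τ := fun τ s =>
    ((hYd τ s).const_mul ε).congr_deriv (by ring)
  have hξd : ∀ τ s, HasDerivAt (fun t => √(1 / 2 * Real.exp t) * unitClamp s)
      (1 / 2 * (√(1 / 2 * Real.exp τ) * unitClamp s)) τ := by
    intro τ s
    refine ((((Real.hasDerivAt_exp τ).const_mul (1 / 2)).sqrt
      (hwpos τ s).ne').mul_const (unitClamp s)).congr_deriv ?_
    have h2 : √(1 / 2 * Real.exp τ) * √(1 / 2 * Real.exp τ) = 1 / 2 * Real.exp τ :=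
      Real.mul_self_sqrt (hwpos τ s).le
    have h3 : √(1 / 2 * Real.exp τ) ≠ 0 := (Real.sqrt_pos.2 (hwpos τ s)).ne'
    rw [div_mul_eq_mul_div, div_eq_iff (by positivity)]
    linear_combination (-unitClamp s) * h2
  have hlam : ∃ C : ℝ, ∀ τ s, τ₀ ≤ τ → lam l (ε * wellRadius V qM (c s * Real.exp τ))
      (√(1 / 2 * Real.exp τ) * unitClamp s) ^ m ≤ C * Real.exp (m / (2 * l) * τ) := by
    obtain ⟨C, hC⟩ := exists_lam_rpow_le hl hV m τ₀
    refine ⟨C, fun τ s hτ => hC _ _ τ hτ ?_⟩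
    have hε1 : |ε| = 1 := by rwa [← pow_eq_one_iff_of_nonneg (abs_nonneg ε) two_ne_zero, sq_abs]
    have habs : |ε * wellRadius V qM (c s * Real.exp τ)| = wellRadius V qM (c s * Real.exp τ) := by
      rw [abs_mul, abs_of_pos (hYpos τ s), hε1, one_mul]
    rw [hV.eq_abs, habs, potential_wellRadius hqM
      (mul_pos (by linarith [hc s]) (Real.exp_pos τ)), mul_pow, Real.sq_sqrt (hwpos τ s).le, hcdef]
    ring
  have hfs := ExpSymbol.comp_phaseSymbol hf (continuous_const.mul hYc)
    (((by fun_prop : Continuous fun q : ℝ × ℝ => √(1 / 2 * Real.exp q.1))).mul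
      (continuous_unitClamp.comp continuous_snd))
    (fun k _ => hα k) (fun k _ => ExpSymbol.const τ₀ k (1 / 2)) hxd hξd hlam
  have h := hfs.mul ((hW.const_mul 2).mul (hY.mul hD))
  convert h using 1
  · ring
  · funext τ s
    have := (hYpos τ s).ne'
    rw [outerArc, mul_inv, mul_inv_cancel_left₀ this]

end Arcs

/-- The integrand defining the orbit average of `f` at energy `E`. -/
def orbitIntegrand (V : ℝ → ℝ) (f : ℝ → ℝ → ℝ) (E q : ℝ) : ℝ :=
  (f q √(E - V q) + f q (-√(E - V q))) / √(E - V q)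

lemma ExpSymbol.continuous_right {τ₀ μ : ℝ} {n : ℕ} {a : ℝ → ℝ → ℝ} (ha : ExpSymbol τ₀ n μ a)
    (τ : ℝ) : Continuous (a τ) :=
  ha.continuous.comp (Continuous.prodMk_right τ)

section ChangeOfVariables

variable {l m τ : ℝ} {V qM : ℝ → ℝ} {f : ℝ → ℝ → ℝ}

lemma image_radial (hl : 1 ≤ l) (hV : GoodPotential l V) (hqM : IsTurningPoint V qM) :
    (fun t : ℝ => wellRadius V qM ((1 - t ^ 2 / 2) * Real.exp τ)) '' Set.Ioo 0 1 =
      Set.Ioo (wellRadius V qM (1 / 2 * Real.exp τ)) (wellRadius V qM (Real.exp τ)) := by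
  have hE := Real.exp_pos τ
  have hmono := wellRadius_strictMonoOn hl hV hqM
  ext q
  constructor
  · rintro ⟨t, ⟨h0, h1⟩, rfl⟩
    have ht : t ^ 2 < 1 := by nlinarith
    have hc : 1 / 2 < 1 - t ^ 2 / 2 := by linarith
    have hc1 : 1 - t ^ 2 / 2 < 1 := by nlinarith
    have hpos : 0 < (1 - t ^ 2 / 2) * Real.exp τ := mul_pos (by linarith) hE
    exact ⟨hmono (Set.mem_Ioi.2 (by positivity)) hpos (by gcongr),
      hmono hpos hE (mul_lt_of_lt_one_left hE hc1)⟩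
  · rintro ⟨h0, h1⟩
    have hhalf : 0 < 1 / 2 * Real.exp τ := by positivity
    have hy := wellRadius_pos hqM hhalf
    have hq : 0 < q := hy.trans h0
    have hVm := hV.strictMonoOn hl
    have h2 := hVm (Set.mem_Ici.2 hy.le) (Set.mem_Ici.2 hq.le) h0
    have h3 := hVm (Set.mem_Ici.2 hq.le) (Set.mem_Ici.2 (wellRadius_pos hqM hE).le) h1
    rw [potential_wellRadius hqM hhalf] at h2
    rw [potential_wellRadius hqM hE] at h3
    have h4 : (V q - V 0) / Real.exp τ < 1 := by rw [div_lt_one hE]; linarith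
    have h5 : 1 / 2 < (V q - V 0) / Real.exp τ := by rw [lt_div_iff₀ hE]; linarith
    refine ⟨√(2 * (1 - (V q - V 0) / Real.exp τ)), ⟨Real.sqrt_pos.2 (by linarith), ?_⟩, ?_⟩
    · rw [Real.sqrt_lt' one_pos]
      linarith
    · simp only
      rw [Real.sq_sqrt (by linarith), ← wellRadius_potential hl hV hqM hq]
      congr 1
      rw [wellRadius_potential hl hV hqM hq]
      field_simp
      ring

lemma abs_deriv_mul_orbitIntegrand (hl : 1 ≤ l) (hV : GoodPotential l V)
    (hqM : IsTurningPoint V qM) {ε : ℝ} (hε : |ε| = 1) {t : ℝ} (ht : t ∈ Set.Ioo (0 : ℝ) 1) :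
    |(deriv V (wellRadius V qM ((1 - t ^ 2 / 2) * Real.exp τ)))⁻¹ * (-t * Real.exp τ)| *
        orbitIntegrand V f (V 0 + Real.exp τ)
          (ε * wellRadius V qM ((1 - t ^ 2 / 2) * Real.exp τ)) =
      outerArc V qM f ε τ t + outerArc V qM f ε τ (-t) := by
  obtain ⟨h0, h1⟩ := ht
  have hE := Real.exp_pos τ
  have hpos : 0 < (1 - t ^ 2 / 2) * Real.exp τ := mul_pos (by nlinarith) hE
  have hφ := wellRadius_pos hqM hpos
  have hd := hV.deriv_pos hl hφ
  have hw : 0 < √(1 / 2 * Real.exp τ) := by positivity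
  have hww : √(1 / 2 * Real.exp τ) * √(1 / 2 * Real.exp τ) = 1 / 2 * Real.exp τ :=
    Real.mul_self_sqrt (by positivity)
  have hsq : √(V 0 + Real.exp τ - V (ε * wellRadius V qM ((1 - t ^ 2 / 2) * Real.exp τ))) =
      √(1 / 2 * Real.exp τ) * t := by
    rw [hV.eq_abs (ε * _), abs_mul, hε, one_mul, abs_of_pos hφ, potential_wellRadius hqM hpos,
      Real.sqrt_eq_iff_mul_self_eq (by nlinarith [sq_nonneg t]) (by positivity)]
    linear_combination (-t ^ 2) * hww
  rw [abs_mul, abs_of_pos (inv_pos.2 hd), neg_mul, abs_neg, abs_of_pos (mul_pos h0 hE),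
    orbitIntegrand, hsq, outerArc, outerArc, unitClamp_of_mem ⟨by linarith, h1.le⟩,
    unitClamp_of_mem ⟨by linarith, by linarith⟩, neg_sq, mul_neg]
  have hE2 : Real.exp τ = 2 * (√(1 / 2 * Real.exp τ) * √(1 / 2 * Real.exp τ)) := by
    rw [hww]; ring
  set φ := wellRadius V qM ((1 - t ^ 2 / 2) * Real.exp τ)
  set w := √(1 / 2 * Real.exp τ)
  rw [hE2]
  field_simp

lemma radial_coeff_pos {t : ℝ} (ht : t ∈ Set.Ioo (0 : ℝ) 1) :
    0 < (1 - t ^ 2 / 2) * Real.exp τ :=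
  mul_pos (by nlinarith [ht.1, ht.2]) (Real.exp_pos τ)

lemma hasDerivWithinAt_radial_coeff (hl : 1 ≤ l) (hV : GoodPotential l V)
    (hqM : IsTurningPoint V qM) : ∀ t ∈ Set.Ioo (0 : ℝ) 1, HasDerivWithinAt
      (fun t : ℝ => wellRadius V qM ((1 - t ^ 2 / 2) * Real.exp τ))
      ((deriv V (wellRadius V qM ((1 - t ^ 2 / 2) * Real.exp τ)))⁻¹ * (-t * Real.exp τ))
      (Set.Ioo 0 1) t := by
  intro t ht
  have h : HasDerivAt (fun t : ℝ => (1 - t ^ 2 / 2) * Real.exp τ) (-t * Real.exp τ) t :=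
    (((((hasDerivAt_id t).pow 2).div_const 2).const_sub 1).mul_const (Real.exp τ)).congr_deriv
      (by simp)
  exact ((hasDerivAt_wellRadius hl hV hqM (radial_coeff_pos ht)).comp t h).hasDerivWithinAt

lemma injOn_radial_coeff (hl : 1 ≤ l) (hV : GoodPotential l V) (hqM : IsTurningPoint V qM) :
    Set.InjOn (fun t : ℝ => wellRadius V qM ((1 - t ^ 2 / 2) * Real.exp τ)) (Set.Ioo 0 1) := by
  intro s hs t ht h
  have h1 := (wellRadius_strictMonoOn hl hV hqM).injOn (radial_coeff_pos hs)
    (radial_coeff_pos ht) h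
  have h2 : 1 - s ^ 2 / 2 = 1 - t ^ 2 / 2 := mul_right_cancel₀ (Real.exp_pos τ).ne' h1
  exact (pow_left_inj₀ hs.1.le ht.1.le two_ne_zero).1 (by linarith)

lemma integral_Ioo_add_comp_neg {F : ℝ → ℝ} (hF : Continuous F) :
    ∫ t in Set.Ioo (0 : ℝ) 1, (F t + F (-t)) = ∫ s in (-1 : ℝ)..1, F s := by
  have hFn : Continuous (fun t => F (-t)) := hF.comp continuous_neg
  rw [← integral_Ioc_eq_integral_Ioo, ← intervalIntegral.integral_of_le zero_le_one,
    intervalIntegral.integral_add (hF.intervalIntegrable _ _) (hFn.intervalIntegrable _ _),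
    intervalIntegral.integral_comp_neg, neg_zero, add_comm,
    intervalIntegral.integral_add_adjacent_intervals (hF.intervalIntegrable _ _)
      (hF.intervalIntegrable _ _)]

lemma integral_outerArc (hl : 1 ≤ l) (hV : GoodPotential l V) (hqM : IsTurningPoint V qM)
    (hf : PhaseSymbol l m 0 f) {ε : ℝ} (hε : ε ^ 2 = 1) :
    IntervalIntegrable (fun q => orbitIntegrand V f (V 0 + Real.exp τ) (ε * q)) volume
        (wellRadius V qM (1 / 2 * Real.exp τ)) (wellRadius V qM (Real.exp τ)) ∧
      ∫ q in (wellRadius V qM (1 / 2 * Real.exp τ))..(wellRadius V qM (Real.exp τ)),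
        orbitIntegrand V f (V 0 + Real.exp τ) (ε * q) =
      ∫ s in (-1 : ℝ)..1, outerArc V qM f ε τ s := by
  have hε1 : |ε| = 1 := by rwa [← pow_eq_one_iff_of_nonneg (abs_nonneg ε) two_ne_zero, sq_abs]
  have hE := Real.exp_pos τ
  have hle : wellRadius V qM (1 / 2 * Real.exp τ) ≤ wellRadius V qM (Real.exp τ) :=
    ((wellRadius_strictMonoOn hl hV hqM) (Set.mem_Ioi.2 (by positivity)) hE (by linarith)).le
  have hcont : Continuous (outerArc V qM f ε τ) :=
    (expSymbol_outerArc hl hV hqM hf hε τ).continuous_right τ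
  have hder := hasDerivWithinAt_radial_coeff (τ := τ) hl hV hqM
  have hinj := injOn_radial_coeff (τ := τ) hl hV hqM
  have hint : IntegrableOn (fun t => outerArc V qM f ε τ t + outerArc V qM f ε τ (-t))
      (Set.Ioo 0 1) :=
    ((hcont.add (hcont.comp continuous_neg)).integrableOn_Icc (a := 0) (b := 1)).mono_set
      Set.Ioo_subset_Icc_self
  constructor
  · rw [intervalIntegrable_iff_integrableOn_Ioo_of_le hle, ← image_radial hl hV hqM,
      integrableOn_image_iff_integrableOn_abs_deriv_smul measurableSet_Ioo hder hinj]
    refine hint.congr_fun (fun t ht => ?_) measurableSet_Ioo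
    rw [smul_eq_mul]
    exact (abs_deriv_mul_orbitIntegrand hl hV hqM hε1 ht).symm
  · rw [intervalIntegral.integral_of_le hle, integral_Ioc_eq_integral_Ioo,
      ← image_radial hl hV hqM,
      integral_image_eq_integral_abs_deriv_smul measurableSet_Ioo hder hinj,
      ← integral_Ioo_add_comp_neg hcont]
    refine setIntegral_congr_fun measurableSet_Ioo fun t ht => ?_
    rw [smul_eq_mul]
    exact abs_deriv_mul_orbitIntegrand hl hV hqM hε1 ht

lemma integral_innerArc (hl : 1 ≤ l) (hV : GoodPotential l V) (hqM : IsTurningPoint V qM)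
    (hf : PhaseSymbol l m 0 f) :
    IntervalIntegrable (fun q => orbitIntegrand V f (V 0 + Real.exp τ) q) volume
        (-wellRadius V qM (1 / 2 * Real.exp τ)) (wellRadius V qM (1 / 2 * Real.exp τ)) ∧
      ∫ q in (-wellRadius V qM (1 / 2 * Real.exp τ))..(wellRadius V qM (1 / 2 * Real.exp τ)),
        orbitIntegrand V f (V 0 + Real.exp τ) q =
      ∫ s in (-1 : ℝ)..1, (innerArc V qM f 1 τ s + innerArc V qM f (-1) τ s) := by
  have hy := wellRadius_pos hqM (by positivity : 0 < 1 / 2 * Real.exp τ)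
  have hcont : ∀ {ε : ℝ}, ε ^ 2 = 1 → Continuous (innerArc V qM f ε τ) := fun hε =>
    (expSymbol_innerArc hl hV hqM hf hε τ).continuous_right τ
  have hadd : Continuous (fun s => innerArc V qM f 1 τ s + innerArc V qM f (-1) τ s) :=
    (hcont (by norm_num)).add (hcont (by norm_num))
  have heq : ∀ s ∈ Set.Icc (-1 : ℝ) 1,
      innerArc V qM f 1 τ s + innerArc V qM f (-1) τ s =
        wellRadius V qM (1 / 2 * Real.exp τ) * orbitIntegrand V f (V 0 + Real.exp τ)
          (wellRadius V qM (1 / 2 * Real.exp τ) * s) := by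
    intro s hs
    rw [innerArc, innerArc, orbitIntegrand, unitClamp_of_mem hs, one_mul, neg_one_mul,
      ← sub_add, add_comm (V 0), sub_add_eq_add_sub]
    ring
  set y := wellRadius V qM (1 / 2 * Real.exp τ)
  have hscale : ∀ q, q ∈ Set.uIcc (-y) y → orbitIntegrand V f (V 0 + Real.exp τ) q =
      y⁻¹ * (innerArc V qM f 1 τ (q / y) + innerArc V qM f (-1) τ (q / y)) := by
    intro q hq
    rw [Set.uIcc_of_le (by linarith)] at hq
    rw [heq (q / y) ⟨by rw [le_div_iff₀ hy]; linarith [hq.1],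
      by rw [div_le_iff₀ hy]; linarith [hq.2]⟩,
      mul_div_cancel₀ _ hy.ne', inv_mul_cancel_left₀ hy.ne']
  constructor
  · refine IntervalIntegrable.congr (fun q hq => (hscale q (Set.uIoc_subset_uIcc hq)).symm) ?_
    exact (continuous_const.mul (hadd.comp (continuous_id.div_const y))).intervalIntegrable _ _
  · rw [intervalIntegral.integral_congr hscale, intervalIntegral.integral_const_mul,
      intervalIntegral.integral_comp_div
        (fun s => innerArc V qM f 1 τ s + innerArc V qM f (-1) τ s) hy.ne', neg_div,
      div_self hy.ne', smul_eq_mul, inv_mul_cancel_left₀ hy.ne']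

/-- The integrand on `[-1, 1]` whose integral is that of `f` over the energy curve
`ξ² + V x = V 0 + exp τ`. -/
def arcIntegrand (V qM : ℝ → ℝ) (f : ℝ → ℝ → ℝ) (τ s : ℝ) : ℝ :=
  innerArc V qM f 1 τ s + innerArc V qM f (-1) τ s +
    (outerArc V qM f 1 τ s + outerArc V qM f (-1) τ s)

lemma expSymbol_arcIntegrand (hl : 1 ≤ l) (hV : GoodPotential l V) (hqM : IsTurningPoint V qM)
    {n : ℕ} (hf : PhaseSymbol l m n f) (τ₀ : ℝ) :
    ExpSymbol τ₀ n (m / (2 * l) + (1 / (2 * l) - 1 / 2)) (arcIntegrand V qM f) := by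
  have hn : (-1 : ℝ) ^ 2 = 1 := by norm_num
  have h1 : (1 : ℝ) ^ 2 = 1 := by norm_num
  exact ((expSymbol_innerArc hl hV hqM hf h1 τ₀).add (expSymbol_innerArc hl hV hqM hf hn τ₀)).add
    ((expSymbol_outerArc hl hV hqM hf h1 τ₀).add (expSymbol_outerArc hl hV hqM hf hn τ₀))

lemma integral_orbitIntegrand (hl : 1 ≤ l) (hV : GoodPotential l V) (hqM : IsTurningPoint V qM)
    (hf : PhaseSymbol l m 0 f) :
    IntervalIntegrable (fun q => orbitIntegrand V f (V 0 + Real.exp τ) q) volume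
        (-wellRadius V qM (Real.exp τ)) (wellRadius V qM (Real.exp τ)) ∧
    ∫ q in (-wellRadius V qM (Real.exp τ))..(wellRadius V qM (Real.exp τ)),
        orbitIntegrand V f (V 0 + Real.exp τ) q =
      ∫ s in (-1 : ℝ)..1, arcIntegrand V qM f τ s := by
  have hn : (-1 : ℝ) ^ 2 = 1 := by norm_num
  have h1 : (1 : ℝ) ^ 2 = 1 := by norm_num
  obtain ⟨hri, hr⟩ := integral_outerArc (τ := τ) hl hV hqM hf h1
  obtain ⟨hli, hl'⟩ := integral_outerArc (τ := τ) hl hV hqM hf hn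
  obtain ⟨hmi, hm⟩ := integral_innerArc (τ := τ) hl hV hqM hf
  simp only [one_mul] at hri hr
  simp only [neg_one_mul] at hli hl'
  rw [intervalIntegral.integral_comp_neg] at hl'
  have hli' := (IntervalIntegrable.iff_comp_neg).1 hli
  simp only [neg_neg] at hli'
  have hcont : ∀ {g : ℝ → ℝ → ℝ}, ExpSymbol 0 0 (m / (2 * l) + (1 / (2 * l) - 1 / 2)) g →
      IntervalIntegrable (g τ) volume (-1) 1 := fun h =>
    (h.continuous_right τ).intervalIntegrable _ _
  have hI1 := hcont (expSymbol_innerArc hl hV hqM hf h1 0)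
  have hI2 := hcont (expSymbol_innerArc hl hV hqM hf hn 0)
  have hO1 := hcont (expSymbol_outerArc hl hV hqM hf h1 0)
  have hO2 := hcont (expSymbol_outerArc hl hV hqM hf hn 0)
  refine ⟨(hli'.symm.trans hmi).trans hri, ?_⟩
  rw [← intervalIntegral.integral_add_adjacent_intervals (hli'.symm.trans hmi) hri,
    ← intervalIntegral.integral_add_adjacent_intervals hli'.symm hmi, hl', hm, hr]
  simp only [arcIntegrand]
  rw [intervalIntegral.integral_add (hI1.add hI2) (hO1.add hO2),
    intervalIntegral.integral_add hO1 hO2]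
  ring

end ChangeOfVariables

section OrbitAverage

variable {l m τ : ℝ} {V qM : ℝ → ℝ}

lemma period_eq_integral_arcIntegrand (hl : 1 ≤ l) (hV : GoodPotential l V)
    (hqM : IsTurningPoint V qM) :
    period V qM (V 0 + Real.exp τ) = ∫ s in (-1 : ℝ)..1, arcIntegrand V qM (fun _ _ => 1) τ s := by
  obtain ⟨hi, h⟩ := integral_orbitIntegrand (τ := τ) hl hV hqM (PhaseSymbol.const l 0 1)
  have hb := wellRadius_pos hqM (Real.exp_pos τ)
  rw [← h, period]
  change 4 * (∫ q in (0 : ℝ)..wellRadius V qM (Real.exp τ), _) = _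
  set b := wellRadius V qM (Real.exp τ)
  have hsub : ∀ {u v : ℝ}, u ∈ Set.Icc (-b) b → v ∈ Set.Icc (-b) b →
      IntervalIntegrable (fun q => orbitIntegrand V (fun _ _ => 1) (V 0 + Real.exp τ) q)
        volume u v := fun hu hv =>
    hi.mono_set (by
      rw [Set.uIcc_of_le (by linarith : -b ≤ b)]
      exact Set.uIcc_subset_Icc hu hv)
  have h0 : (0 : ℝ) ∈ Set.Icc (-b) b := ⟨by linarith, hb.le⟩
  have heven := intervalIntegral.integral_comp_neg (a := 0) (b := b)
    (fun q => orbitIntegrand V (fun _ _ => 1) (V 0 + Real.exp τ) q)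
  simp only [orbitIntegrand, hV.even, neg_zero] at heven
  rw [← intervalIntegral.integral_add_adjacent_intervals
    (hsub ⟨le_rfl, by linarith⟩ h0) (hsub h0 ⟨by linarith, le_rfl⟩)]
  simp only [orbitIntegrand]
  rw [← heven]
  simp only [div_eq_mul_inv]
  rw [intervalIntegral.integral_const_mul]
  ring

lemma le_integral_arcIntegrand (hl : 1 ≤ l) (hV : GoodPotential l V)
    (hqM : IsTurningPoint V qM) (τ : ℝ) :
    2 * (Real.exp (-(1 / 2) * τ) * wellRadius V qM (1 / 2 * Real.exp τ)) ≤
      ∫ s in (-1 : ℝ)..1, arcIntegrand V qM (fun _ _ => 1) τ s := by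
  have hE := Real.exp_pos τ
  have hy := wellRadius_pos hqM (by positivity : 0 < 1 / 2 * Real.exp τ)
  have hcont := (expSymbol_arcIntegrand hl hV hqM (PhaseSymbol.const l 0 1) 0).continuous_right τ
  have hbound : ∀ s, Real.exp (-(1 / 2) * τ) * wellRadius V qM (1 / 2 * Real.exp τ) ≤
      arcIntegrand V qM (fun _ _ => 1) τ s := by
    intro s
    have hgap := inner_gap hl hV hqM τ s
    have hupper : Real.exp τ -
        (V (wellRadius V qM (1 / 2 * Real.exp τ) * unitClamp s) - V 0) ≤ Real.exp τ := by
      linarith [hV.zero_le hl (wellRadius V qM (1 / 2 * Real.exp τ) * unitClamp s)]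
    have hd := hV.deriv_pos hl (wellRadius_pos hqM
      (mul_pos (by linarith [(outer_coeff_mem s).1] : 0 < 1 - unitClamp s ^ 2 / 2) hE))
    have hinv : Real.exp (-(1 / 2) * τ) ≤ (√(Real.exp τ -
        (V (wellRadius V qM (1 / 2 * Real.exp τ) * unitClamp s) - V 0)))⁻¹ := by
      rw [neg_mul, Real.exp_neg]
      gcongr
      · exact Real.sqrt_pos.2 (by linarith)
      · refine (Real.sqrt_le_sqrt hupper).trans_eq ?_
        rw [← Real.exp_half]
        congr 1
        ring
    have hmul := mul_le_mul_of_nonneg_right hinv hy.le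
    have h0 := (Real.exp_pos (-(1 / 2) * τ)).le.trans hinv
    simp only [arcIntegrand, innerArc, outerArc, one_mul]
    have : 0 ≤ 2 * √(1 / 2 * Real.exp τ) *
        (deriv V (wellRadius V qM ((1 - unitClamp s ^ 2 / 2) * Real.exp τ)))⁻¹ := by positivity
    nlinarith [mul_nonneg h0 hy.le]
  have h := intervalIntegral.integral_mono_on (a := -1) (b := 1) (μ := volume) (by norm_num)
    (continuous_const.intervalIntegrable _ _) (hcont.intervalIntegrable _ _) fun s _ => hbound s
  rw [intervalIntegral.integral_const] at h
  norm_num at h ⊢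
  exact h

lemma exists_le_wellRadius (hl : 1 ≤ l) (hV : GoodPotential l V) (hqM : IsTurningPoint V qM)
    (τ₀ : ℝ) : ∃ δ : ℝ, 0 < δ ∧ ∀ τ, τ₀ ≤ τ →
      δ * Real.exp (1 / (2 * l) * τ) ≤ wellRadius V qM (1 / 2 * Real.exp τ) := by
  obtain ⟨δ, hδ, h⟩ := le_radial_weight hl hV hqM (c := fun _ => 1 / 2) (fun _ => le_rfl) τ₀
  refine ⟨δ ^ (1 / (2 * l)), by positivity, fun τ hτ => ?_⟩
  have hy := wellRadius_pos hqM (by positivity : 0 < 1 / 2 * Real.exp τ)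
  have h1 := Real.rpow_le_rpow (by positivity) (h τ 0 hτ) (by positivity : 0 ≤ 1 / (2 * l))
  rw [Real.mul_rpow hδ.le (Real.exp_pos τ).le, ← Real.exp_mul, ← Real.rpow_mul hy.le,
    mul_one_div_cancel (by positivity), Real.rpow_one, mul_comm τ] at h1
  exact h1

lemma expSymbol_orbitAverage (hl : 1 ≤ l) (hV : GoodPotential l V) (hqM : IsTurningPoint V qM)
    {n : ℕ} {f : ℝ → ℝ → ℝ} (hf : PhaseSymbol l m n f) (τ₀ : ℝ) :
    ExpSymbol τ₀ n (m / (2 * l)) (fun τ _ =>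
      (∫ s in (-1 : ℝ)..1, arcIntegrand V qM (fun _ _ => 1) τ s)⁻¹ *
        ∫ s in (-1 : ℝ)..1, arcIntegrand V qM f τ s) := by
  have hT := (expSymbol_arcIntegrand hl hV hqM (PhaseSymbol.const l n 1) τ₀).integral (-1) 1
  have hJ := (expSymbol_arcIntegrand hl hV hqM hf τ₀).integral (-1) 1
  have hlow := le_integral_arcIntegrand hl hV hqM
  obtain ⟨δ, hδ, hr⟩ := exists_le_wellRadius hl hV hqM τ₀
  have hTi := hT.inv (c := 2 * δ) (fun τ _ => lt_of_lt_of_le (mul_pos two_pos (mul_pos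
    (Real.exp_pos _) (wellRadius_pos hqM (by positivity : 0 < 1 / 2 * Real.exp τ)))) (hlow τ))
    (by positivity) fun τ _ hτ => by
      refine le_trans ?_ (hlow τ)
      have h := mul_le_mul_of_nonneg_left (hr τ hτ) (Real.exp_pos (-(1 / 2) * τ)).le
      rw [show (0 / (2 * l) + (1 / (2 * l) - 1 / 2)) * τ = -(1 / 2) * τ + 1 / (2 * l) * τ by ring,
        Real.exp_add]
      linarith
  have h := hTi.mul hJ
  convert h using 1
  ring

lemma orbitAvg_eq (hl : 1 ≤ l) (hV : GoodPotential l V) (hqM : IsTurningPoint V qM)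
    {f : ℝ → ℝ → ℝ} (hf : PhaseSymbol l m 0 f) {E : ℝ} (hE : V 0 < E) :
    orbitAvg V qM f E =
      (∫ s in (-1 : ℝ)..1, arcIntegrand V qM (fun _ _ => 1) (Real.log (E - V 0)) s)⁻¹ *
        ∫ s in (-1 : ℝ)..1, arcIntegrand V qM f (Real.log (E - V 0)) s := by
  have hexp : V 0 + Real.exp (Real.log (E - V 0)) = E := by
    rw [Real.exp_log (sub_pos.2 hE), add_sub_cancel]
  rw [← period_eq_integral_arcIntegrand hl hV hqM, ← (integral_orbitIntegrand hl hV hqM hf).2]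
  simp only [wellRadius, hexp]
  rfl

lemma orbitAvg_eq_zero (hl : 1 ≤ l) (hV : GoodPotential l V) (hqM : IsTurningPoint V qM)
    {p : ℝ → ℝ → ℝ} {E₀ : ℝ} (hvan : ∀ x ξ : ℝ, ξ ^ 2 + V x ≤ E₀ → p x ξ = 0) {E : ℝ}
    (hE : V 0 < E) (hE₀ : E ≤ E₀) : orbitAvg V qM p E = 0 := by
  obtain ⟨hb, hVb, -⟩ := hqM E hE
  rw [orbitAvg, intervalIntegral.integral_congr (g := fun _ => 0), intervalIntegral.integral_zero,
    mul_zero]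
  intro q hq
  rw [Set.uIcc_of_le (by linarith)] at hq
  have hVq : V q ≤ E := by
    rw [← hVb, hV.le_iff hl hb.le]
    exact abs_le.2 hq
  have hsq : √(E - V q) ^ 2 = E - V q := Real.sq_sqrt (by linarith)
  simp only
  rw [hvan q _ (by rw [hsq]; linarith), hvan q _ (by rw [neg_sq, hsq]; linarith), add_zero,
    zero_div]

lemma exists_sub_rpow_le_jap {v E₀ : ℝ} (hv : v < E₀) (ρ : ℝ) :
    ∃ C : ℝ, ∀ E, E₀ ≤ E → (E - v) ^ ρ ≤ C * jap E ^ ρ := by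
  have hd := sub_pos.2 hv
  refine ⟨(((1 + |v|) / (E₀ - v) + 1)⁻¹) ^ ρ + (1 + |v|) ^ ρ, fun E hE => ?_⟩
  have hj := one_le_jap E
  have hjE := abs_le_jap E
  have hjle : jap E ≤ 1 + |E| := by
    rw [jap, Real.sqrt_le_left (by positivity), ← sq_abs E]
    nlinarith [abs_nonneg E]
  refine rpow_le_of_comparable (by positivity) (by linarith) ?_ ?_ ρ
  · rw [inv_mul_le_iff₀ (by positivity)]
    have h1 : 1 + |v| ≤ (1 + |v|) / (E₀ - v) * (E - v) := by
      rw [div_mul_eq_mul_div, le_div_iff₀ hd]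
      gcongr
    have h2 : |E| ≤ (E - v) + |v| := by
      calc |E| = |(E - v) + v| := by rw [sub_add_cancel]
        _ ≤ |E - v| + |v| := abs_add_le _ _
        _ = (E - v) + |v| := by rw [abs_of_pos (by linarith)]
    linarith
  · nlinarith [le_abs_self E, neg_abs_le v, abs_nonneg v]

end OrbitAverage

/-- the orbit average of a symbol `p ∈ S^{m₁,m₂}` vanishing below energy
`E₀ > V 0` is `C^∞` on `(V 0, ∞)`, vanishes on `(V 0, E₀]` and is of class
`S̃^{m₁+[m₂]}`. -/
theorem stmt0 (l : ℝ) (hl : 1 ≤ l) (V : ℝ → ℝ) (hV : GoodPotential l V)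
    (qM : ℝ → ℝ) (hqM : IsTurningPoint V qM)
    (m₁ m₂ : ℝ) (p : ℝ → ℝ → ℝ) (hp : IsSymbol l m₁ m₂ p)
    (E₀ : ℝ) (hE₀ : V 0 < E₀)
    (hvan : ∀ x ξ : ℝ, ξ ^ 2 + V x ≤ E₀ → p x ξ = 0) :
    ContDiffOn ℝ (⊤ : ℕ∞) (orbitAvg V qM p) (Set.Ioi (V 0)) ∧
    (∀ E : ℝ, V 0 < E → E ≤ E₀ → orbitAvg V qM p E = 0) ∧
    ∀ k : ℕ, ∃ C : ℝ, ∀ E : ℝ, V 0 < E →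
      |iteratedDerivWithin k (orbitAvg V qM p) (Set.Ioi (V 0)) E|
        ≤ C * jap E ^ ((m₁ + max m₂ 0) / (2 * l) - (k : ℝ)) := by
  have hcv : ∀ n : ℕ, ContDiffOn ℝ n (orbitAvg V qM p) (Set.Ioi (V 0)) ∧ ∀ k ≤ n, ∃ C, ∀ E,
      E₀ ≤ E → |iteratedDerivWithin k (orbitAvg V qM p) (Set.Ioi (V 0)) E| ≤
        C * (E - V 0) ^ ((m₁ + max m₂ 0) / (2 * l) - k) := by
    intro n
    have h := (expSymbol_orbitAverage hl hV hqM (hp.phaseSymbol hl n)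
      (Real.log (E₀ - V 0))).contDiffOn_comp_log (ν := 0) (v₀ := V 0) (f := orbitAvg V qM p)
      fun E hE => by rw [Real.rpow_zero, one_mul, orbitAvg_eq hl hV hqM (hp.phaseSymbol hl 0) hE]
    rwa [Real.exp_log (sub_pos.2 hE₀), add_sub_cancel, add_zero] at h
  have hzero : ∀ E, V 0 < E → E ≤ E₀ → orbitAvg V qM p E = 0 := fun E hE hE' =>
    orbitAvg_eq_zero hl hV hqM hvan hE hE'
  refine ⟨contDiffOn_infty.2 fun n => (hcv n).1, hzero, fun k => ?_⟩
  obtain ⟨C, hC⟩ := (hcv k).2 k le_rfl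
  obtain ⟨D, hD⟩ := exists_sub_rpow_le_jap hE₀ ((m₁ + max m₂ 0) / (2 * l) - k)
  have hbound : ∀ E, E₀ ≤ E →
      |iteratedDerivWithin k (orbitAvg V qM p) (Set.Ioi (V 0)) E| ≤
        |C| * |D| * jap E ^ ((m₁ + max m₂ 0) / (2 * l) - (k : ℝ)) := by
    intro E hE
    have hj := Real.rpow_pos_of_pos (jap_pos E) ((m₁ + max m₂ 0) / (2 * l) - (k : ℝ))
    have hs := Real.rpow_pos_of_pos (by linarith : 0 < E - V 0)
      ((m₁ + max m₂ 0) / (2 * l) - (k : ℝ))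
    calc |iteratedDerivWithin k (orbitAvg V qM p) (Set.Ioi (V 0)) E|
        ≤ C * (E - V 0) ^ ((m₁ + max m₂ 0) / (2 * l) - k) := hC E hE
      _ ≤ |C| * (E - V 0) ^ ((m₁ + max m₂ 0) / (2 * l) - k) := by
          gcongr
          exact le_abs_self C
      _ ≤ |C| * (|D| * jap E ^ ((m₁ + max m₂ 0) / (2 * l) - (k : ℝ))) := by
          gcongr
          refine (hD E hE).trans ?_
          gcongr
          exact le_abs_self D
      _ = _ := by ring
  refine ⟨|C| * |D|, fun E hE => ?_⟩
  rcases le_or_gt E₀ E with h | h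
  · exact hbound E h
  · have hj := Real.rpow_pos_of_pos (jap_pos E) ((m₁ + max m₂ 0) / (2 * l) - (k : ℝ))
    have hev : orbitAvg V qM p =ᶠ[nhds E] fun _ => 0 := by
      filter_upwards [Ioo_mem_nhds hE h] with E' hE'
      exact hzero E' hE'.1 hE'.2.le
    rw [(hev.filter_mono nhdsWithin_le_nhds).iteratedDerivWithin_eq hev.self_of_nhds]
    simp only [iteratedDerivWithin_fun_const_zero, abs_zero]
    positivity
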